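/- Fix k' ∈ {0,4,6,8,10,14} and a constant 0 < c < 2/9, and let m = m(ℓ) be a sequence with m(ℓ)/ℓ → c as ℓ → ∞. Set k = 12ℓ + k'. Then all ℓ − m zeros of the Miller basis form f_{k,m} that correspond to roots of its Faber polynomial lie on the arc 𝒜, and for any π/2 ≤ θ₁ ≤ θ₂ ≤ 2π/3 the proportion of these zeros of the form e^{iθ} with θ ∈ [θ₁, θ₂] converges, as ℓ → ∞, to (6/(π(1−c)))(θ₂ − θ₁) + (2c/(1−c))(cos θ₂ − cos θ₁). -/

import Mathlib

open Complex Polynomial Real MeasureTheory Filter Topology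

noncomputable section

/-- `q = e^{2πiz}`. -/
def qexp (z : ℂ) : ℂ := Complex.exp (2 * Real.pi * Complex.I * z)

/-- The normalized Eisenstein series `E_k(z) = (1/2) ∑_{gcd(c,d)=1} (cz+d)^{-k}`,
with the convention `E_0 = 1`. -/
def Eis (k : ℕ) (z : ℂ) : ℂ :=
  if k = 0 then 1
  else (1 / 2) * ∑' p : ℤ × ℤ, if Int.gcd p.1 p.2 = 1 then 1 / ((p.1 : ℂ) * z + (p.2 : ℂ)) ^ k else 0

/-- The modular discriminant `Δ(z) = q ∏_{n ≥ 1} (1 - q^n)^24`, `q = e^{2πiz}`. -/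
def Disc (z : ℂ) : ℂ := qexp z * ∏' n : ℕ, (1 - qexp z ^ (n + 1)) ^ 24

/-- The modular `j`-invariant `j = E₄³ / Δ`. -/
def jinv (z : ℂ) : ℂ := Eis 4 z ^ 3 / Disc z

/-- The coefficient of `q^d` in the Fourier/`q`-expansion of a `1`-periodic function
holomorphic on the upper half-plane, computed at height `1`. -/
def qCoeff (f : ℂ → ℂ) (d : ℤ) : ℂ :=
  ∫ x in (0:ℝ)..1,
    f (x + Complex.I) * Complex.exp (-(2 * Real.pi * Complex.I * d * (x + Complex.I)))

/-- `c_N(d)`: the coefficient of `q^d` in the Laurent expansion of `j^N`. -/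
def cj (N : ℕ) (d : ℤ) : ℂ := qCoeff (fun z => jinv z ^ N) d

/-- `A_n = (1/2π) ∫_{π/2}^{2π/3} j(e^{iθ})^n dθ`. -/
def Acoef (n : ℕ) : ℂ :=
  (1 / (2 * Real.pi)) *
    ∫ θ in (Real.pi / 2)..(2 * Real.pi / 3), jinv (Complex.exp (θ * Complex.I)) ^ n

/-- `B_n = -c_n(0)`, where `c_n(0)` is the coefficient of `q^0` in `j^n`. -/
def Bcoef (n : ℕ) : ℂ := - cj n 0

/-- `C_n(k') = 0` for `k' ∈ {0,4,8}` and `C_n(k') = -1728^n/2` for `k' ∈ {6,10,14}`. -/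
def Ccoef (n k' : ℕ) : ℂ := if k' = 6 ∨ k' = 10 ∨ k' = 14 then -(1728 : ℂ) ^ n / 2 else 0

/-- Real-valued version of `A_n` (recall `j` is real on the arc). -/
def AcoefR (n : ℕ) : ℝ :=
  (1 / (2 * Real.pi)) *
    ∫ θ in (Real.pi / 2)..(2 * Real.pi / 3), (jinv (Complex.exp (θ * Complex.I)) ^ n).re

/-- Real-valued version of `B_n = -c_n(0)` (recall `c_n(0)` is an integer). -/
def BcoefR (n : ℕ) : ℝ := - (cj n 0).re

/-- Real-valued version of `C_n(k')`. -/
def CcoefR (n k' : ℕ) : ℝ := if k' = 6 ∨ k' = 10 ∨ k' = 14 then -(1728 : ℝ) ^ n / 2 else 0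

/-- `f` is the `m`-th element `f_{k,m} = q^m + O(q^{ℓ+1})` of the Miller basis of `M_k`,
`k = 12ℓ + k'`: it is holomorphic on the upper half-plane, weight-`k` modular for
`SL₂(ℤ)`, and has a convergent `q`-expansion whose coefficients in degrees `≤ ℓ`
are `δ_{d,m}`. -/
def IsMillerForm (ℓ k' m : ℕ) (f : ℂ → ℂ) : Prop :=
  (∀ z : ℂ, 0 < z.im → DifferentiableAt ℂ f z) ∧
  (∀ z : ℂ, 0 < z.im → f (z + 1) = f z) ∧
  (∀ z : ℂ, 0 < z.im → f (-1 / z) = z ^ (12 * ℓ + k') * f z) ∧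
  (∃ a : ℕ → ℂ,
    (∀ z : ℂ, 0 < z.im →
      Summable (fun n : ℕ => a n * qexp z ^ n) ∧ f z = ∑' n : ℕ, a n * qexp z ^ n) ∧
    (∀ d : ℕ, d ≤ ℓ → a d = if d = m then 1 else 0))

/-- `F` is the Faber polynomial of `f = f_{k,m}`, `k = 12ℓ + k'`: the monic polynomial
of degree `ℓ - m` with `f = Δ^ℓ ⬝ E_{k'} ⬝ F(j)`. -/
def IsFaber (ℓ k' m : ℕ) (f : ℂ → ℂ) (F : Polynomial ℂ) : Prop :=
  F.Monic ∧ F.natDegree = ℓ - m ∧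
  ∀ z : ℂ, 0 < z.im → f z = Disc z ^ ℓ * Eis k' z * F.eval (jinv z)

/-- The sum of the `n`-th powers of the zeros of `F`, counted with multiplicity. -/
def powerSumRoots (F : Polynomial ℂ) (n : ℕ) : ℂ := (F.roots.map (fun x => x ^ n)).sum

/-- The (finite) solutions of `d_1 + 2 d_2 + ⋯ + n d_n = n` in nonnegative integers,
indexed by `Fin n` (so index `t : Fin n` stands for `d_{t+1}`).  Note any solution
automatically has `d_t ≤ n`. -/
def sols (n : ℕ) : Finset (Fin n → ℕ) :=
  (Fintype.piFinset fun _ : Fin n => Finset.range (n + 1)).filter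
    (fun d => ∑ t : Fin n, ((t : ℕ) + 1) * d t = n)

section
set_option autoImplicit false

open scoped Manifold
open UpperHalfPlane ModularForm MatrixGroups EisensteinSeries in
lemma Eis_eq_E {k : ℕ} (hk : 3 ≤ k) (τ : ℍ) : Eis k (τ : ℂ) = ModularForm.E hk τ := by
  have h1 : ModularForm.E hk τ = (1/2 : ℂ) * eisensteinSeries (N := 1) 0 k τ := rfl
  rw [h1, Eis, if_neg (by omega), eisensteinSeries]
  congr 1
  rw [tsum_subtype (gammaSet 1 1 0) (fun x => eisSummand k x τ)]
  rw [← (finTwoArrowEquiv ℤ).symm.tsum_eq]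
  refine tsum_congr fun p => ?_
  classical
  rw [Set.indicator_apply]
  have : ((finTwoArrowEquiv ℤ).symm p ∈ gammaSet 1 1 0) ↔ Int.gcd p.1 p.2 = 1 := by
    rw [gammaSet_one_mem_iff]; simp
  simp only [this]
  split_ifs
  · simp [eisSummand]
  · rfl

open UpperHalfPlane ModularForm in
lemma Disc_eq (τ : ℍ) : Disc (τ : ℂ) = ModularForm.discriminant τ := by
  rw [discriminant_eq_q_prod, Disc]
  have : Function.Periodic.qParam 1 (τ:ℂ) = qexp τ := by
    simp [Function.Periodic.qParam, qexp]
  rw [this]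
  have h2 : (fun n : ℕ => (1 - qexp (τ:ℂ) ^ (n + 1)) ^ 24) = fun n : ℕ => (1 - eta_q n (τ:ℂ)) ^ 24 := by
    funext n
    rw [← this, eta_q]
  rw [h2]

open UpperHalfPlane ModularForm MatrixGroups in
lemma weight14_zero (G : ℍ → ℂ) (hγ : ∀ γ : SL(2, ℤ), SlashAction.map (14:ℤ) γ G = G)
   (hG : MDiff G) (h0 : IsZeroAtImInfty G) : G = 0 := by
  let g : CuspForm 𝒮ℒ 14 := {
    toFun := G
    slash_action_eq' := by
      rintro A ⟨A, rfl⟩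
      exact hγ A
    holo' := hG
    zero_at_cusps' := by
      intro c hc
      rw [Subgroup.IsArithmetic.isCusp_iff_isCusp_SL2Z] at hc
      rw [OnePoint.isZeroAt_iff_forall_SL2Z hc]
      intro γ _
      rw [hγ]; exact h0 }
  have h2 : CuspForm.discriminantEquiv g = 0 :=
    rank_zero_iff_forall_zero.mp ModularForm.levelOne_weight_two_rank_zero _
  have h3 : g = 0 := by
    simpa using h2
  have : (g : ℍ → ℂ) = 0 := by rw [h3]; rfl
  exact this

end

section
set_option autoImplicit false

open scoped Manifold

open UpperHalfPlane ModularForm MatrixGroups EisensteinSeries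

/-- q-disc version of the Eisenstein series -/
def ec (k : ℕ) : ℂ → ℂ := if h : 3 ≤ k then cuspFunction 1 (ModularForm.E h) else fun _ => 1

/-- q-disc version of `Δ/q` -/
def dd (q : ℂ) : ℂ := ∏' n : ℕ, (1 - q ^ (n + 1)) ^ 24

/-- q-disc version of `q*j` -/
def uu (q : ℂ) : ℂ := ec 4 q ^ 3 / dd q

lemma qexp_eq (z : ℂ) : qexp z = Function.Periodic.qParam 1 z := by
  simp [Function.Periodic.qParam, qexp]

lemma norm_qexp (z : ℂ) : ‖qexp z‖ = Real.exp (-2 * π * z.im) := by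
  rw [qexp, Complex.norm_exp]; simp

lemma norm_qexp_lt_one {z : ℂ} (hz : 0 < z.im) : ‖qexp z‖ < 1 := by
  rw [norm_qexp]; apply Real.exp_lt_one_iff.2; have := Real.pi_pos; nlinarith [mul_pos this hz]

lemma qexp_ne_zero (z : ℂ) : qexp z ≠ 0 := Complex.exp_ne_zero _

lemma qexp_surj {q : ℂ} (h0 : q ≠ 0) (h1 : ‖q‖ < 1) : ∃ z : ℂ, 0 < z.im ∧ qexp z = q := by
  refine ⟨Function.Periodic.invQParam 1 q, Function.Periodic.im_invQParam_pos_of_norm_lt_one one_pos h1 h0, ?_⟩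
  rw [qexp_eq, Function.Periodic.qParam_right_inv one_ne_zero h0]

lemma ec_diff (k : ℕ) {q : ℂ} (hq : ‖q‖ < 1) : DifferentiableAt ℂ (ec k) q := by
  unfold ec
  split_ifs with h
  · exact ModularFormClass.differentiableAt_cuspFunction _ one_pos one_mem_strictPeriods_SL hq
  · exact differentiableAt_const _

lemma ec_qexp {k : ℕ} (hk : k = 0 ∨ 3 ≤ k) {z : ℂ} (hz : 0 < z.im) : ec k (qexp z) = Eis k z := by
  unfold ec
  rcases hk with rfl | h
  · simp [Eis]
  · rw [dif_pos h, qexp_eq]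
    have := Eis_eq_E h ⟨z, hz⟩
    simp only at this
    rw [this]
    exact SlashInvariantFormClass.eq_cuspFunction _ ⟨z, hz⟩ one_mem_strictPeriods_SL one_ne_zero

lemma ec_zero {k : ℕ} (hk : Even k) : ec k 0 = 1 := by
  unfold ec
  split_ifs with h
  · have := E_qExpansion_coeff_zero h hk
    rw [qExpansion_coeff] at this
    simpa using this
  · rfl

lemma dd_diff {q : ℂ} (hq : ‖q‖ < 1) : DifferentiableAt ℂ dd q :=
  (differentiableOn_tprod_one_sub_pow_pow 24).differentiableAt (Metric.isOpen_ball.mem_nhds (by simpa using hq))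

lemma Disc_eq_dd (z : ℂ) : Disc z = qexp z * dd (qexp z) := rfl

lemma dd_zero : dd 0 = 1 := by simp [dd]

lemma Disc_ne_zero {z : ℂ} (hz : 0 < z.im) : Disc z ≠ 0 := by
  have := discriminant_ne_zero ⟨z, hz⟩
  rwa [← Disc_eq] at this

lemma dd_ne_zero {q : ℂ} (hq : ‖q‖ < 1) : dd q ≠ 0 := by
  by_cases h0 : q = 0
  · rw [h0, dd_zero]; exact one_ne_zero
  · obtain ⟨z, hz, rfl⟩ := qexp_surj h0 hq
    have := Disc_ne_zero hz
    rw [Disc_eq_dd] at this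
    exact right_ne_zero_of_mul this

lemma uu_diff {q : ℂ} (hq : ‖q‖ < 1) : DifferentiableAt ℂ uu q :=
  ((ec_diff 4 hq).pow 3).div (dd_diff hq) (dd_ne_zero hq)

lemma uu_zero : uu 0 = 1 := by simp [uu, ec_zero (k := 4) (by decide), dd_zero]

lemma jinv_eq_uu {z : ℂ} (hz : 0 < z.im) : jinv z = uu (qexp z) / qexp z := by
  rw [jinv, Disc_eq_dd, uu, ec_qexp (by norm_num) hz]
  rw [div_div, mul_comm]

lemma Eis_T {k : ℕ} (hk : k = 0 ∨ 3 ≤ k) {z : ℂ} (hz : 0 < z.im) : Eis k (z + 1) = Eis k z := by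
  rw [← ec_qexp hk hz, ← ec_qexp hk (by simpa using hz)]
  congr 1
  rw [qexp, qexp, mul_add, Complex.exp_add, mul_one, Complex.exp_two_pi_mul_I, mul_one]

lemma qexp_add_int (z : ℂ) (n : ℤ) : qexp (z + n) = qexp z := by
  rw [qexp, qexp, mul_add, Complex.exp_add, mul_comm _ (n : ℂ), Complex.exp_int_mul_two_pi_mul_I, mul_one]

lemma qexp_T (z : ℂ) : qexp (z + 1) = qexp z := by
  simpa using qexp_add_int z 1

lemma Disc_T (z : ℂ) : Disc (z + 1) = Disc z := by
  rw [Disc_eq_dd, Disc_eq_dd, qexp_T]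

lemma S_im_pos {z : ℂ} (hz : 0 < z.im) : 0 < (-1 / z).im := by
  have := UpperHalfPlane.im_inv_neg_coe_pos ⟨z, hz⟩
  have e : -1 / z = (-z)⁻¹ := by rw [neg_div, one_div, inv_neg]
  rw [e]; exact this

lemma S_smul_coe {z : ℂ} (hz : 0 < z.im) : ((ModularGroup.S • (⟨z, hz⟩ : ℍ) : ℍ) : ℂ) = -1 / z := by
  rw [UpperHalfPlane.modular_S_smul]
  rw [neg_div, one_div, ← inv_neg]

lemma Eis_S {k : ℕ} (hk : k = 0 ∨ 3 ≤ k) {z : ℂ} (hz : 0 < z.im) : Eis k (-1 / z) = z ^ k * Eis k z := by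
  rcases hk with rfl | h
  · simp [Eis]
  · have : SlashInvariantFormClass (ModularForm 𝒮ℒ (k:ℤ)) (CongruenceSubgroup.Gamma 1) k :=
      CongruenceSubgroup.Gamma_one_coe_eq_SL ▸ inferInstance
    have := SlashInvariantForm.slash_action_eqn_SL'' (ModularForm.E h) (CongruenceSubgroup.mem_Gamma_one ModularGroup.S) ⟨z, hz⟩
    rw [← Eis_eq_E, ← Eis_eq_E, S_smul_coe, ModularGroup.denom_S] at this
    simpa using this

lemma Disc_S {z : ℂ} (hz : 0 < z.im) : Disc (-1 / z) = z ^ 12 * Disc z := by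
  have : SlashInvariantFormClass (CuspForm 𝒮ℒ 12) (CongruenceSubgroup.Gamma 1) 12 :=
      CongruenceSubgroup.Gamma_one_coe_eq_SL ▸ inferInstance
  have := SlashInvariantForm.slash_action_eqn_SL'' (CuspForm.discriminant) (CongruenceSubgroup.mem_Gamma_one ModularGroup.S) ⟨z, hz⟩
  rw [ModularGroup.denom_S] at this
  simp only [CuspForm.coe_discriminant] at this
  rw [← Disc_eq, ← Disc_eq, S_smul_coe] at this
  exact_mod_cast this

lemma jinv_T {z : ℂ} (hz : 0 < z.im) : jinv (z + 1) = jinv z := by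
  rw [jinv, jinv, Disc_T, Eis_T (by norm_num) hz]

lemma jinv_S {z : ℂ} (hz : 0 < z.im) : jinv (-1 / z) = jinv z := by
  have : z ≠ 0 := by rintro rfl; simp at hz
  rw [jinv, jinv, Disc_S hz, Eis_S (by norm_num) hz]
  have := Disc_ne_zero hz
  field_simp

end

section
set_option autoImplicit false

open scoped Manifold
open UpperHalfPlane hiding I
open ModularForm MatrixGroups EisensteinSeries

lemma qexp_diff (z : ℂ) : DifferentiableAt ℂ qexp z := by unfold qexp; fun_prop

lemma qexp_hasDeriv (z : ℂ) : HasDerivAt qexp (2 * π * I * qexp z) z := by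
  unfold qexp
  have := ((hasDerivAt_id z).const_mul (2 * π * I : ℂ)).cexp
  simp only [id, mul_one] at this
  rw [mul_comm (2 * π * I : ℂ) (Complex.exp _)]; exact this

lemma disc14 (h : ℂ → ℂ) (hd : ∀ q, ‖q‖ < 1 → DifferentiableAt ℂ h q) (h0 : h 0 = 0)
    (hS : ∀ z : ℂ, 0 < z.im → h (qexp (-1 / z)) = z ^ 14 * h (qexp z)) :
    ∀ q, ‖q‖ < 1 → h q = 0 := by
  have key : (fun τ : ℍ => h (qexp τ)) = 0 := by
    apply weight14_zero
    · apply SlashInvariantForm.slash_action_generators_SL2Z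
      · ext τ
        rw [SlashInvariantForm.slash_S_apply]
        have := hS τ τ.2
        have e : (-(τ : ℂ))⁻¹ = -1 / τ := by rw [neg_div, one_div, inv_neg]
        simp only
        rw [e, this]
        have := τ.ne_zero
        rw [zpow_neg]
        field_simp
      · ext τ
        rw [SL_slash_apply, UpperHalfPlane.modular_T_smul]
        have e : denom (ModularGroup.T : GL (Fin 2) ℝ) τ = 1 := by
          rw [ModularGroup.denom_apply]; simp [ModularGroup.T]
        rw [e]
        simp [UpperHalfPlane.coe_vadd, add_comm (1:ℂ), qexp_T]
    · rw [UpperHalfPlane.mdifferentiable_iff]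
      intro z hz
      have : DifferentiableAt ℂ (fun z => h (qexp z)) z :=
        (hd _ (norm_qexp_lt_one hz)).comp z (qexp_diff z)
      refine (this.congr_of_eventuallyEq ?_).differentiableWithinAt
      filter_upwards [(isOpen_lt continuous_const Complex.continuous_im).mem_nhds hz] with w hw
      simp [UpperHalfPlane.ofComplex_apply_of_im_pos hw]
    · have : Tendsto (fun τ : ℍ => qexp τ) atImInfty (𝓝 0) := by
        simp_rw [qexp_eq]
        exact UpperHalfPlane.qParam_tendsto_atImInfty one_pos
      have h2 := ((hd 0 (by simp)).continuousAt.tendsto).comp this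
      rw [h0] at h2
      exact h2
  intro q hq
  by_cases hq0 : q = 0
  · rw [hq0, h0]
  · obtain ⟨z, hz, rfl⟩ := qexp_surj hq0 hq
    exact congrFun key ⟨z, hz⟩

lemma ec_S {k : ℕ} (hk : k = 0 ∨ 3 ≤ k) {z : ℂ} (hz : 0 < z.im) : ec k (qexp (-1 / z)) = z ^ k * ec k (qexp z) := by
  rw [ec_qexp hk hz, ec_qexp hk (S_im_pos hz), Eis_S hk hz]

lemma ec_mul_aux (a b : ℕ) (ha : Even a) (hb : Even b) (ha' : a = 0 ∨ 3 ≤ a) (hb' : b = 0 ∨ 3 ≤ b)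
    (hab : a + b = 14) {q : ℂ} (hq : ‖q‖ < 1) : ec a q * ec b q = ec 14 q := by
  refine sub_eq_zero.1 (disc14 (fun q => ec a q * ec b q - ec 14 q) ?_ ?_ ?_ q hq)
  · intro q hq
    exact ((ec_diff a hq).mul (ec_diff b hq)).sub (ec_diff 14 hq)
  · simp [ec_zero ha, ec_zero hb, ec_zero (k := 14) (by decide)]
  · intro z hz
    simp only [ec_S ha' hz, ec_S hb' hz, ec_S (k := 14) (by norm_num) hz]
    rw [← hab, pow_add]
    ring

lemma ec_mul {k' : ℕ} (hk' : k' = 0 ∨ k' = 4 ∨ k' = 6 ∨ k' = 8 ∨ k' = 10 ∨ k' = 14)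
    {q : ℂ} (hq : ‖q‖ < 1) : ec k' q * ec (14 - k') q = ec 14 q := by
  rcases hk' with rfl | rfl | rfl | rfl | rfl | rfl <;>
  exact ec_mul_aux _ _ (by decide) (by decide) (by norm_num) (by norm_num) rfl hq

lemma ec14 {q : ℂ} (hq : ‖q‖ < 1) : ec 4 q ^ 2 * ec 6 q = ec 14 q := by
  refine sub_eq_zero.1 (disc14 (fun q => ec 4 q ^ 2 * ec 6 q - ec 14 q) ?_ ?_ ?_ q hq)
  · intro q hq
    exact (((ec_diff 4 hq).pow 2).mul (ec_diff 6 hq)).sub (ec_diff 14 hq)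
  · simp [ec_zero (k := 4) (by decide), ec_zero (k := 6) (by decide), ec_zero (k := 14) (by decide)]
  · intro z hz
    simp only [ec_S (k := 4) (by norm_num) hz, ec_S (k := 6) (by norm_num) hz, ec_S (k := 14) (by norm_num) hz]
    ring

lemma ec_E6 {q : ℂ} (hq : ‖q‖ < 1) : ec 4 q ^ 3 - ec 6 q ^ 2 = 1728 * (q * dd q) := by
  by_cases hq0 : q = 0
  · simp [hq0, ec_zero (k := 4) (by decide), ec_zero (k := 6) (by decide)]
  · obtain ⟨z, hz, rfl⟩ := qexp_surj hq0 hq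
    have := discriminant_eq_E₄_cube_sub_E₆_sq ⟨z, hz⟩
    rw [← Disc_eq] at this
    rw [← Disc_eq_dd, ec_qexp (by norm_num) hz, ec_qexp (by norm_num) hz]
    have h4 := Eis_eq_E (k := 4) (by norm_num) ⟨z, hz⟩
    have h6 := Eis_eq_E (k := 6) (by norm_num) ⟨z, hz⟩
    simp only at h4 h6 this
    rw [h4, h6, this]
    field_simp

lemma jinv_hasDeriv {z : ℂ} (hz : 0 < z.im) :
    HasDerivAt jinv (2 * π * I * (deriv uu (qexp z) - uu (qexp z) / qexp z)) z := by
  have h1 := ((uu_diff (norm_qexp_lt_one hz)).hasDerivAt.comp z (qexp_hasDeriv z)).div (qexp_hasDeriv z) (qexp_ne_zero z)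
  have h2 := h1.congr_of_eventuallyEq (f₁ := jinv) (by
    filter_upwards [(isOpen_lt continuous_const Complex.continuous_im).mem_nhds hz] with w hw
    simp [jinv_eq_uu hw])
  refine h2.congr_deriv ?_
  have := qexp_ne_zero z
  simp
  field_simp

lemma uu_deriv {q : ℂ} (hq : ‖q‖ < 1) : dd q * (uu q - q * deriv uu q) = ec 14 q := by
  have hdu : ∀ q : ℂ, ‖q‖ < 1 → DifferentiableAt ℂ (deriv uu) q := by
    intro q hq
    have : DifferentiableOn ℂ uu (Metric.ball 0 1) := fun x hx =>
      (uu_diff (by simpa using hx)).differentiableWithinAt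
    exact (this.deriv Metric.isOpen_ball).differentiableAt (Metric.isOpen_ball.mem_nhds (by simpa using hq))
  refine sub_eq_zero.1 (disc14 (fun q => dd q * (uu q - q * deriv uu q) - ec 14 q) ?_ ?_ ?_ q hq)
  · intro q hq
    exact ((dd_diff hq).mul ((uu_diff hq).sub (differentiableAt_id.mul (hdu q hq)))).sub (ec_diff 14 hq)
  · simp [dd_zero, uu_zero, ec_zero (k := 14) (by decide)]
  · intro z hz
    have hz0 : z ≠ 0 := by rintro rfl; simp at hz
    simp only [ec_S (k := 14) (by norm_num) hz]
    have hA : ∀ z : ℂ, 0 < z.im → dd (qexp z) * (uu (qexp z) - qexp z * deriv uu (qexp z)) =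
        - Disc z * deriv jinv z / (2 * π * I) := by
      intro z hz
      rw [(jinv_hasDeriv hz).deriv, Disc_eq_dd]
      have := qexp_ne_zero z
      have := Complex.two_pi_I_ne_zero
      field_simp
      ring
    rw [hA z hz, hA _ (S_im_pos hz), Disc_S hz]
    have h1 : HasDerivAt (fun w : ℂ => -1 / w) (1 / z ^ 2) z := by
      have := (hasDerivAt_inv hz0).neg
      have e : (fun w : ℂ => -1 / w) = -fun y => y⁻¹ := by ext w; simp [neg_div]
      rw [e, one_div, ← neg_neg ((z ^ 2)⁻¹)]; exact this
    have h2 := (jinv_hasDeriv (S_im_pos hz)).differentiableAt.hasDerivAt.comp z h1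
    have h3 := h2.congr_of_eventuallyEq (f₁ := jinv) (by
      filter_upwards [(isOpen_lt continuous_const Complex.continuous_im).mem_nhds hz] with w hw
      simp [jinv_S hw])
    rw [h3.deriv]
    set X := deriv jinv (-1 / z)
    have := Complex.two_pi_I_ne_zero
    field_simp

end

section
set_option autoImplicit false

open scoped Manifold

lemma residue_lemma {r R : ℝ} (hr : 0 < r) (hrR : r < R) (S : Finset ℂ) : ∀ (N D : ℂ → ℂ)
    (_ : DifferentiableOn ℂ N (Metric.ball 0 R)) (_ : DifferentiableOn ℂ D (Metric.ball 0 R))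
    (_ : ∀ p ∈ S, ‖p‖ < r ∧ D p = 0 ∧ deriv D p ≠ 0)
    (_ : ∀ q, ‖q‖ ≤ r → D q = 0 → q ∈ S),
    (∮ q in C(0, r), N q / D q) = 2 * π * I * ∑ p ∈ S, N p / deriv D p := by
  classical
  have hsub : Metric.closedBall (0:ℂ) r ⊆ Metric.ball 0 R := Metric.closedBall_subset_ball hrR
  induction S using Finset.induction_on with
  | empty =>
    intro N D hN hD _ hz
    simp only [Finset.sum_empty, mul_zero]
    have hdiff : DifferentiableOn ℂ (fun q => N q / D q) (Metric.closedBall 0 r) := by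
      apply (hN.mono hsub).div (hD.mono hsub)
      intro q hq h0
      simpa using hz q (by simpa using hq) h0
    apply Complex.circleIntegral_eq_zero_of_differentiable_on_off_countable hr.le Set.countable_empty
    · exact hdiff.continuousOn
    · intro z hz
      exact hdiff.differentiableAt (Filter.mem_of_superset (Metric.isOpen_ball.mem_nhds hz.1) Metric.ball_subset_closedBall)
  | insert p S hpS ih =>
    intro N D hN hD hS hz
    obtain ⟨hp1, hp2, hp3⟩ := hS p (Finset.mem_insert_self _ _)
    have hpB : Metric.ball (0:ℂ) R ∈ 𝓝 p := Metric.isOpen_ball.mem_nhds (by simpa using hp1.trans hrR)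
    set D1 := dslope D p with hD1
    have hD1d : DifferentiableOn ℂ D1 (Metric.ball 0 R) := (Complex.differentiableOn_dslope hpB).2 hD
    have hDD1 : ∀ q, D q = (q - p) * D1 q := by
      intro q
      have := sub_smul_dslope D p q
      rw [hp2, sub_zero, smul_eq_mul] at this
      exact this.symm
    have hD1p : D1 p = deriv D p := dslope_same _ _
    set c := N p / D1 p with hc
    set M := fun q => N q - c * D1 q with hM
    have hMd : DifferentiableOn ℂ M (Metric.ball 0 R) := hN.sub (hD1d.const_mul c)
    have hMp : M p = 0 := by
      simp only [hM, hc]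
      rw [div_mul_cancel₀, sub_self]
      rwa [hD1p]
    set N1 := dslope M p with hN1
    have hN1d : DifferentiableOn ℂ N1 (Metric.ball 0 R) := (Complex.differentiableOn_dslope hpB).2 hMd
    have hMN1 : ∀ q, N q - c * D1 q = (q - p) * N1 q := by
      intro q
      have := sub_smul_dslope M p q
      rw [hMp, sub_zero, smul_eq_mul] at this
      exact this.symm
    have hne : ∀ p' ∈ S, p' ≠ p := fun p' h h' => hpS (h' ▸ h)
    have hD1' : ∀ p' ∈ S, D1 p' = 0 := by
      intro p' hp'
      have h1 := (hS p' (Finset.mem_insert_of_mem hp')).2.1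
      rw [hDD1] at h1
      exact (mul_eq_zero.1 h1).resolve_left (sub_ne_zero.2 (hne p' hp'))
    have hder : ∀ p' ∈ S, deriv D p' = (p' - p) * deriv D1 p' := by
      intro p' hp'
      have e : D = fun q => (q - p) * D1 q := funext hDD1
      have hd : DifferentiableAt ℂ D1 p' := hD1d.differentiableAt
        (Metric.isOpen_ball.mem_nhds (by simpa using (hS p' (Finset.mem_insert_of_mem hp')).1.trans hrR))
      rw [e]
      have := ((hasDerivAt_id p').sub_const p).mul hd.hasDerivAt
      rw [hD1' p' hp'] at this
      have h3 := this.deriv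
      simp only [id, mul_zero, zero_add] at h3
      exact h3
    have IH := ih N1 D1 hN1d hD1d (by
      intro p' hp'
      have h1 := hS p' (Finset.mem_insert_of_mem hp')
      refine ⟨h1.1, hD1' p' hp', ?_⟩
      have := h1.2.2
      rw [hder p' hp'] at this
      exact right_ne_zero_of_mul this) (by
      intro q hq h0
      have : q ∈ insert p S := hz q hq (by rw [hDD1, h0, mul_zero])
      rcases Finset.mem_insert.1 this with rfl | h
      · exact absurd h0 (by rwa [hD1p])
      · exact h)
    have hsph : ∀ q ∈ Metric.sphere (0:ℂ) r, D1 q ≠ 0 ∧ q - p ≠ 0 := by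
      intro q hq
      have hq' : ‖q‖ = r := by simpa using hq
      have : D q ≠ 0 := by
        intro h0
        have := hS q (hz q hq'.le h0)
        linarith [this.1]
      rw [hDD1] at this
      exact ⟨right_ne_zero_of_mul this, left_ne_zero_of_mul this⟩
    have hcong : (∮ q in C(0, r), N q / D q) = ∮ q in C(0, r), (N1 q / D1 q + c * (q - p)⁻¹) := by
      apply circleIntegral.integral_congr hr.le
      intro q hq
      obtain ⟨h1, h2⟩ := hsph q hq
      have := hMN1 q
      simp only
      rw [hDD1 q, eq_add_of_sub_eq this]
      field_simp
    rw [hcong, circleIntegral.integral_add, IH, circleIntegral.integral_const_mul,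
      circleIntegral.integral_sub_inv_of_mem_ball (by simpa using hp1), Finset.sum_insert hpS, mul_add, add_comm]
    · congr 1
      · rw [hc, hD1p]; ring
      · congr 1
        apply Finset.sum_congr rfl
        intro p' hp'
        rw [hder p' hp']
        have h1 := hMN1 p'
        rw [hD1' p' hp', mul_zero, sub_zero] at h1
        rw [h1, mul_div_mul_left _ _ (sub_ne_zero.2 (hne p' hp'))]
    · apply ContinuousOn.circleIntegrable hr.le
      have hss : Metric.sphere (0:ℂ) r ⊆ Metric.ball 0 R := Metric.sphere_subset_closedBall.trans hsub
      exact (hN1d.continuousOn.mono hss).div (hD1d.continuousOn.mono hss) fun q hq => (hsph q hq).1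
    · apply ContinuousOn.circleIntegrable hr.le
      apply ContinuousOn.mul continuousOn_const
      exact ContinuousOn.inv₀ (by fun_prop) fun q hq => (hsph q hq).2

lemma poly_antideriv (G : ℂ[X]) : ∃ P : ℂ[X], derivative P = G := by
  induction G using Polynomial.induction_on' with
  | add p q hp hq =>
    obtain ⟨P, rfl⟩ := hp
    obtain ⟨Q, rfl⟩ := hq
    exact ⟨P + Q, by simp⟩
  | monomial n a =>
    refine ⟨monomial (n + 1) (a / (n + 1)), ?_⟩
    rw [derivative_monomial]
    congr 1
    have : (n : ℂ) + 1 ≠ 0 := by exact_mod_cast Nat.succ_ne_zero n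
    push_cast
    field_simp

lemma tail_diff (a : ℕ → ℂ) (h : ∀ z : ℂ, 0 < z.im → Summable (fun n : ℕ => a n * qexp z ^ n)) (L : ℕ) :
    DifferentiableOn ℂ (fun q => ∑' n, a (n + L) * q ^ n) (Metric.ball 0 1) := by
  intro q hq
  have hq1 : ‖q‖ < 1 := by simpa using hq
  obtain ⟨ρ, h1, h2⟩ := exists_between hq1
  have hρ : 0 < ρ := (norm_nonneg q).trans_lt h1
  obtain ⟨z, hz, hzq⟩ := qexp_surj (q := (ρ : ℂ)) (by exact_mod_cast hρ.ne') (by simpa [abs_of_pos hρ] using h2)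
  have hs := (h z hz).norm
  rw [hzq] at hs
  have hs2 : Summable (fun n => ‖a (n + L)‖ * ρ ^ n) := by
    have := ((summable_nat_add_iff L).2 hs).mul_right ((ρ ^ L)⁻¹)
    refine this.congr fun n => ?_
    rw [norm_mul, norm_pow, Complex.norm_real, Real.norm_of_nonneg hρ.le, pow_add]
    field_simp
  have := differentiableOn_tsum_of_summable_norm (u := fun n => ‖a (n + L)‖ * ρ ^ n)
    (F := fun n q => a (n + L) * q ^ n) hs2 (U := Metric.ball (0:ℂ) ρ)
    (fun n => by fun_prop) Metric.isOpen_ball (by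
      intro n w hw
      rw [norm_mul, norm_pow]
      have : ‖w‖ ≤ ρ := by simpa using (Metric.mem_ball.1 hw).le
      gcongr)
  exact (this.differentiableAt (Metric.isOpen_ball.mem_nhds (by simpa using h1))).differentiableWithinAt

end

section
set_option autoImplicit false

/-- the kernel numerator -/
def VV (ℓ k' m : ℕ) (q : ℂ) : ℂ := q ^ m * ec (14 - k') q / (q * dd q) ^ (ℓ + 1)

lemma DD_hasDeriv (w : ℂ) {q : ℂ} (hq : ‖q‖ < 1) :
    HasDerivAt (fun q => uu q - w * q) (deriv uu q - w) q := by
  have := (uu_diff hq).hasDerivAt.sub ((hasDerivAt_id q).const_mul w)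
  rw [mul_one] at this; exact this

lemma formula {ℓ k' m : ℕ} (hk' : k' = 0 ∨ k' = 4 ∨ k' = 6 ∨ k' = 8 ∨ k' = 10 ∨ k' = 14)
    (hm : m ≤ ℓ) {f : ℂ → ℂ} {F : ℂ[X]} (hf : IsMillerForm ℓ k' m f) (hF : IsFaber ℓ k' m f F)
    (w : ℂ) {r : ℝ} (hr : 0 < r) (hr1 : r < 1) (S : Finset ℂ)
    (hS : ∀ p ∈ S, ‖p‖ < r ∧ uu p = w * p ∧ ec 14 p ≠ 0)
    (hz : ∀ q, ‖q‖ ≤ r → uu q = w * q → q ∈ S) :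
    F.eval w = ∑ p ∈ S, p ^ m / ((p * dd p) ^ ℓ * ec k' p)
      + (2 * π * I)⁻¹ * ∮ q in C(0, r), VV ℓ k' m q / (uu q - w * q) := by
  obtain ⟨-, -, -, a, ha1, ha2⟩ := hf
  obtain ⟨-, -, hF⟩ := hF
  have hpi := Complex.two_pi_I_ne_zero
  set D : ℂ → ℂ := fun q => uu q - w * q with hD
  set T : ℂ → ℂ := fun q => ∑' n, a (n + (ℓ + 1)) * q ^ n with hT
  have hTd := tail_diff a (fun z hz => (ha1 z hz).1) (ℓ + 1)
  set N : ℂ → ℂ := fun q => T q * ec (14 - k') q / dd q ^ (ℓ + 1) with hN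
  set J : ℂ → ℂ := fun q => uu q / q - deriv uu q with hJ
  have hb : ∀ {q : ℂ}, q ∈ Metric.ball (0:ℂ) 1 → ‖q‖ < 1 := fun h => by simpa using h
  have hNd : DifferentiableOn ℂ N (Metric.ball 0 1) := by
    apply DifferentiableOn.div
    · exact hTd.mul fun q hq => (ec_diff _ (hb hq)).differentiableWithinAt
    · exact fun q hq => ((dd_diff (hb hq)).pow _).differentiableWithinAt
    · exact fun q hq => pow_ne_zero _ (dd_ne_zero (hb hq))
  have hDd : DifferentiableOn ℂ D (Metric.ball 0 1) := fun q hq =>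
    (DD_hasDeriv w (hb hq)).differentiableAt.differentiableWithinAt
  have hDer : ∀ q, ‖q‖ < 1 → deriv D q = deriv uu q - w := fun q hq => (DD_hasDeriv w hq).deriv
  have hduu : DifferentiableOn ℂ (deriv uu) (Metric.ball 0 1) := by
    have : DifferentiableOn ℂ uu (Metric.ball 0 1) := fun x hx =>
      (uu_diff (by simpa using hx)).differentiableWithinAt
    exact this.deriv Metric.isOpen_ball
  have hDder : DifferentiableOn ℂ (fun q => deriv uu q - w) (Metric.ball 0 1) :=
    hduu.sub (differentiableOn_const _)
  -- J facts
  have hJ14 : ∀ q, q ≠ 0 → ‖q‖ < 1 → J q * (q * dd q) = ec 14 q := by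
    intro q h0 hq
    rw [← uu_deriv hq, hJ]
    field_simp
  -- N = F(j) J - V
  have hkey : ∀ q, q ≠ 0 → ‖q‖ < 1 → N q = F.eval (uu q / q) * J q - VV ℓ k' m q := by
    intro q h0 hq
    obtain ⟨z, hz, rfl⟩ := qexp_surj h0 hq
    have hfz := (ha1 z hz).2
    rw [hF z hz, jinv_eq_uu hz, Disc_eq_dd, ← ec_qexp (by omega) hz] at hfz
    have hsplit := (ha1 z hz).1.sum_add_tsum_nat_add (ℓ + 1)
    rw [← hfz] at hsplit
    have h1 : ∑ i ∈ Finset.range (ℓ + 1), a i * qexp z ^ i = qexp z ^ m := by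
      rw [Finset.sum_eq_single m]
      · rw [ha2 m hm, if_pos rfl, one_mul]
      · intro b hb hbm
        rw [ha2 b (by simpa [Nat.lt_succ_iff] using hb), if_neg hbm, zero_mul]
      · intro h; exact absurd (Finset.mem_range.2 (by omega)) h
    have h2 : ∑' i, a (i + (ℓ + 1)) * qexp z ^ (i + (ℓ + 1)) = qexp z ^ (ℓ + 1) * T (qexp z) := by
      rw [hT, ← tsum_mul_left]
      refine tsum_congr fun n => ?_
      rw [pow_add]; ring
    rw [h1, h2] at hsplit
    have hd := dd_ne_zero hq
    have hJ2 : J (qexp z) = ec k' (qexp z) * ec (14 - k') (qexp z) / (qexp z * dd (qexp z)) := by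
      rw [ec_mul hk' hq, ← hJ14 _ h0 hq]
      field_simp
    rw [hJ2]
    simp only [hN, VV]
    have hT2 : T (qexp z) = ((qexp z * dd (qexp z)) ^ ℓ * ec k' (qexp z) * eval (uu (qexp z) / qexp z) F - qexp z ^ m) / qexp z ^ (ℓ + 1) := by
      rw [← hsplit]
      have := pow_ne_zero (ℓ + 1) h0
      field_simp
      ring
    rw [hT2]
    field_simp
    ring
  have hS' : ∀ p ∈ S, ‖p‖ < r ∧ D p = 0 ∧ deriv D p ≠ 0 ∧ p ≠ 0 ∧ deriv D p = - J p := by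
    intro p hp
    obtain ⟨h1, h2, h3⟩ := hS p hp
    have h0 : p ≠ 0 := by
      rintro rfl
      rw [uu_zero, mul_zero] at h2
      exact one_ne_zero h2
    have h4 : deriv D p = - J p := by
      rw [hDer p (h1.trans hr1)]
      simp only [hJ]
      rw [h2]
      field_simp
      ring
    refine ⟨h1, by simp [hD, h2], ?_, h0, h4⟩
    rw [h4]
    have := hJ14 p h0 (h1.trans hr1)
    rw [← this] at h3
    exact neg_ne_zero.2 (left_ne_zero_of_mul h3)
  have hz' : ∀ q, ‖q‖ ≤ r → D q = 0 → q ∈ S := fun q h1 h2 => hz q h1 (sub_eq_zero.1 h2)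
  have R1 := residue_lemma hr hr1 S N D hNd hDd (fun p hp => ⟨(hS' p hp).1, (hS' p hp).2.1, (hS' p hp).2.2.1⟩) hz'
  have R2 := residue_lemma hr hr1 S (fun q => deriv uu q - w) D hDder hDd (fun p hp => ⟨(hS' p hp).1, (hS' p hp).2.1, (hS' p hp).2.2.1⟩) hz'
  have R2' : ∑ p ∈ S, (deriv uu p - w) / deriv D p = (S.card : ℂ) := by
    rw [Finset.sum_congr rfl (g := fun _ => (1:ℂ))]
    · simp
    · intro p hp
      rw [← hDer p ((hS' p hp).1.trans hr1), div_self (hS' p hp).2.2.1]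
  rw [R2'] at R2
  have hsph : ∀ q ∈ Metric.sphere (0:ℂ) r, q ≠ 0 ∧ ‖q‖ < 1 ∧ D q ≠ 0 := by
    intro q hq
    have hq' : ‖q‖ = r := by simpa using hq
    refine ⟨by rintro rfl; simp at hq'; linarith, by linarith, ?_⟩
    intro h0
    linarith [(hS' q (hz' q hq'.le h0)).1]
  -- division
  obtain ⟨G, hG⟩ := Polynomial.X_sub_C_dvd_sub_C_eval (a := w) (p := F)
  obtain ⟨P, hP⟩ := poly_antideriv G
  have hjd : ∀ q, q ≠ 0 → ‖q‖ < 1 → HasDerivAt (fun q => uu q / q) (- J q / q) q := by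
    intro q h0 hq
    have := (uu_diff hq).hasDerivAt.div (hasDerivAt_id q) h0
    refine this.congr_deriv ?_
    simp only [hJ, id]
    field_simp
    ring
  have hGint : (∮ q in C(0, r), G.eval (uu q / q) * (- J q / q)) = 0 := by
    apply circleIntegral.integral_eq_zero_of_hasDerivWithinAt hr.le (f := fun q => P.eval (uu q / q))
    intro q hq
    obtain ⟨h0, h1, -⟩ := hsph q hq
    have := HasDerivAt.comp (h := fun q => uu q / q) q (P.hasDerivAt (uu q / q)) (hjd q h0 h1)
    rw [hP] at this
    exact this.hasDerivWithinAt
  have hss : Metric.sphere (0:ℂ) r ⊆ Metric.ball 0 1 := fun q hq => by simpa using (hsph q hq).2.1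
  have huc : ContinuousOn uu (Metric.sphere (0:ℂ) r) := fun q hq =>
    (uu_diff (hsph q hq).2.1).continuousAt.continuousWithinAt
  have hDc : ContinuousOn D (Metric.sphere (0:ℂ) r) := hDd.continuousOn.mono hss
  have hidc : ContinuousOn (fun q : ℂ => q) (Metric.sphere (0:ℂ) r) := continuousOn_id
  have hjc : ContinuousOn (fun q => uu q / q) (Metric.sphere (0:ℂ) r) :=
    huc.div hidc fun q hq => (hsph q hq).1
  have hdc : ContinuousOn (deriv uu) (Metric.sphere (0:ℂ) r) := hduu.continuousOn.mono hss
  have hJc : ContinuousOn J (Metric.sphere (0:ℂ) r) := hjc.sub hdc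
  have hVc : ContinuousOn (VV ℓ k' m) (Metric.sphere (0:ℂ) r) := by
    intro q hq
    obtain ⟨h0, h1, -⟩ := hsph q hq
    have : DifferentiableAt ℂ (VV ℓ k' m) q := by
      have hdd := dd_ne_zero h1
      have e1 := ec_diff (14 - k') h1
      have e2 := dd_diff h1
      unfold VV
      refine ((differentiableAt_id.pow m).mul e1).div ((differentiableAt_id.mul e2).pow _) ?_
      exact pow_ne_zero _ (mul_ne_zero h0 hdd)
    exact this.continuousAt.continuousWithinAt
  have hI1 : CircleIntegrable (fun q => G.eval (uu q / q) * (- J q / q)) 0 r := by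
    apply ContinuousOn.circleIntegrable hr.le
    exact (G.continuous.comp_continuousOn hjc).mul (hJc.neg.div hidc fun q hq => (hsph q hq).1)
  have hI2 : CircleIntegrable (fun q => (deriv uu q - w) / D q) 0 r := by
    apply ContinuousOn.circleIntegrable hr.le
    exact (hdc.sub continuousOn_const).div hDc fun q hq => (hsph q hq).2.2
  have hI3 : CircleIntegrable (fun q : ℂ => (q - 0)⁻¹) 0 r := by
    apply ContinuousOn.circleIntegrable hr.le
    exact ContinuousOn.inv₀ (by fun_prop) fun q hq => by simpa using (hsph q hq).1
  have hI4 : CircleIntegrable (fun q => VV ℓ k' m q / D q) 0 r := by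
    apply ContinuousOn.circleIntegrable hr.le
    exact hVc.div hDc fun q hq => (hsph q hq).2.2
  have R3 : (∮ q in C(0, r), N q / D q) = ∮ q in C(0, r),
      (((- G.eval (uu q / q) * (- J q / q)) - F.eval w * ((deriv uu q - w) / D q - (q - 0)⁻¹)) - VV ℓ k' m q / D q) := by
    apply circleIntegral.integral_congr hr.le
    intro q hq
    obtain ⟨h0, h1, h2⟩ := hsph q hq
    have e := congrArg (Polynomial.eval (uu q / q)) hG
    simp only [eval_sub, eval_C, eval_mul, eval_X] at e
    have e2 : uu q / q - w = D q / q := by simp only [hD]; field_simp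
    rw [e2] at e
    simp only
    rw [hkey q h0 h1, eq_add_of_sub_eq e, sub_zero]
    have e3 : deriv uu q = uu q / q - J q := by simp [hJ]
    have e4 : uu q = D q + w * q := by simp [hD]
    have e5 : deriv uu q - w = D q / q - J q := by rw [e3, ← e2]; ring
    rw [e5]
    field_simp
    ring
  have hGint' : (∮ q in C(0, r), - G.eval (uu q / q) * (- J q / q)) = 0 := by
    have : (fun q => - G.eval (uu q / q) * (- J q / q)) = fun q => (-1 : ℂ) * (G.eval (uu q / q) * (- J q / q)) := by
      ext q; ring
    rw [this, circleIntegral.integral_const_mul, hGint, mul_zero]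
  have hI1' : CircleIntegrable (fun q => - G.eval (uu q / q) * (- J q / q)) 0 r := by
    apply ContinuousOn.circleIntegrable hr.le
    exact (G.continuous.comp_continuousOn hjc).neg.mul (hJc.neg.div hidc fun q hq => (hsph q hq).1)
  have hI5 : CircleIntegrable (fun q => F.eval w * ((deriv uu q - w) / D q - (q - 0)⁻¹)) 0 r := by
    apply ContinuousOn.circleIntegrable hr.le
    refine continuousOn_const.mul (((hdc.sub continuousOn_const).div hDc fun q hq => (hsph q hq).2.2).sub ?_)
    exact ContinuousOn.inv₀ (by fun_prop) fun q hq => by simpa using (hsph q hq).1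
  have hI6 : CircleIntegrable (fun q => - G.eval (uu q / q) * (- J q / q) - F.eval w * ((deriv uu q - w) / D q - (q - 0)⁻¹)) 0 r := hI1'.sub hI5
  rw [circleIntegral.integral_sub hI6 hI4, circleIntegral.integral_sub hI1' hI5, hGint', circleIntegral.integral_const_mul,
    circleIntegral.integral_sub hI2 hI3, R2, circleIntegral.integral_sub_inv_of_mem_ball (by simpa using hr), R1] at R3
  have R4 : ∑ p ∈ S, N p / deriv D p = - (S.card * F.eval w) + ∑ p ∈ S, p ^ m / ((p * dd p) ^ ℓ * ec k' p) := by
    have : ∀ p ∈ S, N p / deriv D p = - F.eval w + p ^ m / ((p * dd p) ^ ℓ * ec k' p) := by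
      intro p hp
      obtain ⟨h1, h2, h3, h4, h5⟩ := hS' p hp
      have h1' := h1.trans hr1
      rw [h5] at h3 ⊢
      have hJ0 : J p ≠ 0 := neg_ne_zero.1 h3
      rw [hkey p h4 h1']
      have e : uu p / p = w := by rw [(hS p hp).2.1]; field_simp
      rw [e]
      have hd := dd_ne_zero h1'
      have hJ2 := hJ14 p h4 h1'
      rw [← ec_mul hk' h1'] at hJ2
      have hk0 : ec k' p ≠ 0 ∧ ec (14 - k') p ≠ 0 := by
        rw [← mul_ne_zero_iff, ← hJ2]
        exact mul_ne_zero hJ0 (mul_ne_zero h4 hd)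
      obtain ⟨hk1, hk2⟩ := hk0
      have hJ3 : J p = ec k' p * ec (14 - k') p / (p * dd p) := by
        rw [← hJ2]; field_simp
      rw [hJ3]
      simp only [VV]
      field_simp
      ring
    rw [Finset.sum_congr rfl this, Finset.sum_add_distrib]
    simp
  rw [R4] at R3
  apply mul_left_cancel₀ hpi
  rw [mul_add, mul_inv_cancel_left₀ hpi]
  linear_combination -R3

end

section
set_option autoImplicit false

open UpperHalfPlane hiding I
open ModularForm MatrixGroups

/-- `j` on the upper half plane -/
def jH (τ : ℍ) : ℂ := jinv τ

lemma jH_slash (γ : SL(2, ℤ)) : SlashAction.map (0:ℤ) γ jH = jH := by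
  apply SlashInvariantForm.slash_action_generators_SL2Z
  · ext τ
    rw [SlashInvariantForm.slash_S_apply]
    have e : (-(τ : ℂ))⁻¹ = -1 / τ := by rw [neg_div, one_div, inv_neg]
    simp only [jH, e, jinv_S τ.2, neg_zero, zpow_zero, mul_one]
  · ext τ
    rw [SL_slash_apply, UpperHalfPlane.modular_T_smul]
    simp [jH, UpperHalfPlane.coe_vadd, add_comm (1:ℂ), jinv_T τ.2]

lemma jH_smul (γ : SL(2, ℤ)) (τ : ℍ) : jH (γ • τ) = jH τ := by
  have := congrFun (jH_slash γ) τ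
  rw [SL_slash_apply] at this
  simpa using this

lemma jH_smul' (γ : 𝒮ℒ) (τ : ℍ) : jH (γ • τ) = jH τ := by
  obtain ⟨γ, ⟨g, rfl⟩⟩ := γ
  exact jH_smul g τ

lemma jinv_deriv {z : ℂ} (hz : 0 < z.im) : deriv jinv z = - (2 * π * I) * (ec 14 (qexp z) / Disc z) := by
  rw [(jinv_hasDeriv hz).deriv, ← uu_deriv (norm_qexp_lt_one hz), Disc_eq_dd]
  have := qexp_ne_zero z
  have := dd_ne_zero (norm_qexp_lt_one hz)
  field_simp
  ring

lemma jinv_sub {z : ℂ} (hz : 0 < z.im) : jinv z - 1728 = ec 6 (qexp z) ^ 2 / Disc z := by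
  have h := ec_E6 (norm_qexp_lt_one hz)
  rw [← Disc_eq_dd] at h
  have := Disc_ne_zero hz
  rw [jinv, ← ec_qexp (by norm_num) hz]
  field_simp
  linear_combination h

lemma ec14_ne {z : ℂ} (hz : 0 < z.im) (h0 : jinv z ≠ 0) (h1 : jinv z ≠ 1728) : ec 14 (qexp z) ≠ 0 := by
  rw [← ec14 (norm_qexp_lt_one hz)]
  apply mul_ne_zero
  · intro h
    apply h0
    rw [jinv, ← ec_qexp (by norm_num) hz]
    have : ec 4 (qexp z) = 0 := by simpa using h
    simp [this]
  · intro h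
    apply h1
    have := jinv_sub hz
    rw [h] at this
    simpa [sub_eq_zero] using this

lemma jinv_deriv_ne {z : ℂ} (hz : 0 < z.im) (h0 : jinv z ≠ 0) (h1 : jinv z ≠ 1728) : deriv jinv z ≠ 0 := by
  rw [jinv_deriv hz]
  exact mul_ne_zero (neg_ne_zero.2 Complex.two_pi_I_ne_zero) (div_ne_zero (ec14_ne hz h0 h1) (Disc_ne_zero hz))

lemma jinv_analytic {z : ℂ} (hz : 0 < z.im) : AnalyticAt ℂ jinv z := by
  have : DifferentiableOn ℂ jinv {w : ℂ | 0 < w.im} := fun w hw =>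
    (jinv_hasDeriv hw).differentiableAt.differentiableWithinAt
  exact this.analyticAt ((isOpen_lt continuous_const Complex.continuous_im).mem_nhds hz)

lemma jH_cont : Continuous jH := by
  rw [continuous_iff_continuousAt]
  intro τ
  exact ContinuousAt.comp (f := ((↑) : ℍ → ℂ)) (g := jinv) (jinv_analytic τ.2).continuousAt UpperHalfPlane.continuous_coe.continuousAt

lemma jH_large (B : ℝ) : ∃ y : ℝ, ∀ τ : ℍ, y ≤ τ.im → B < ‖jH τ‖ := by
  have h1 : Tendsto uu (𝓝 0) (𝓝 1) := by
    have := (uu_diff (q := 0) (by simp)).continuousAt.tendsto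
    rwa [uu_zero] at this
  have h2 : ∀ᶠ q in 𝓝 (0:ℂ), 1 / 2 < ‖uu q‖ := by
    have := h1.norm
    rw [norm_one] at this
    exact this.eventually (lt_mem_nhds (by norm_num))
  obtain ⟨ε, hε, h3⟩ := Metric.eventually_nhds_iff.1 h2
  have h4 : Tendsto (fun y : ℝ => Real.exp (-2 * π * y)) atTop (𝓝 0) := by
    apply Real.tendsto_exp_atBot.comp
    apply Filter.Tendsto.const_mul_atTop_of_neg _ tendsto_id
    nlinarith [Real.pi_pos]
  have h5 : 0 < min ε (1 / (2 * (|B| + 1))) := by positivity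
  obtain ⟨y, hy⟩ := Filter.eventually_atTop.1 (h4.eventually (gt_mem_nhds h5))
  refine ⟨y, fun τ hτ => ?_⟩
  have h6 := hy τ.im hτ
  have h7 : ‖qexp τ‖ < min ε (1 / (2 * (|B| + 1))) := by rw [norm_qexp]; exact h6
  have h8 := h3 (y := qexp τ) (by simpa using h7.trans_le (min_le_left _ _))
  have h9 := h7.trans_le (min_le_right _ _)
  rw [jH, jinv_eq_uu τ.2, norm_div]
  have hq : 0 < ‖qexp τ‖ := norm_pos_iff.2 (qexp_ne_zero _)
  rw [lt_div_iff₀ hq]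
  have hB := le_abs_self B
  have hB0 := abs_nonneg B
  rw [lt_div_iff₀ (by positivity)] at h9
  nlinarith

lemma jH_open : IsOpenMap jH := by
  intro s hs
  have hU : IsPreconnected {w : ℂ | 0 < w.im} := (convex_halfSpace_im_gt 0).isPreconnected
  rcases AnalyticOnNhd.is_constant_or_isOpen (g := jinv) (U := {w : ℂ | 0 < w.im}) (fun z hz => jinv_analytic hz) hU with ⟨w, hw⟩ | h
  · exfalso
    obtain ⟨y, hy⟩ := jH_large ‖w‖
    have h1 := hy ⟨⟨0, |y| + 1⟩, by positivity⟩ (by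
      show y ≤ |y| + 1
      linarith [le_abs_self y])
    rw [jH, hw _ (UpperHalfPlane.im_pos _)] at h1
    exact lt_irrefl _ h1
  · have := h (((↑) : ℍ → ℂ) '' s) (by rintro _ ⟨τ, -, rfl⟩; exact τ.2) (UpperHalfPlane.isOpenEmbedding_coe.isOpenMap s hs)
    rw [Set.image_image] at this
    exact this

lemma jH_locinj (τ : ℍ) (h0 : jH τ ≠ 0) (h1 : jH τ ≠ 1728) : ∃ U : Set ℍ, IsOpen U ∧ τ ∈ U ∧ Set.InjOn jH U := by
  have hs : HasStrictDerivAt jinv (deriv jinv τ) τ := (jinv_analytic τ.2).hasStrictDerivAt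
  have hne := jinv_deriv_ne τ.2 h0 h1
  obtain ⟨V, hV, hVo⟩ : ∃ V ∈ 𝓝 (τ : ℂ), Set.InjOn jinv V := by
    set e := (hs.hasStrictFDerivAt_equiv hne).toOpenPartialHomeomorph jinv
    refine ⟨e.source, e.open_source.mem_nhds (HasStrictFDerivAt.mem_toOpenPartialHomeomorph_source _), ?_⟩
    exact e.injOn
  obtain ⟨V', hV', hV'o, hm⟩ := mem_nhds_iff.1 hV
  refine ⟨((↑) : ℍ → ℂ) ⁻¹' V', hV'o.preimage UpperHalfPlane.continuous_coe, hm, ?_⟩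
  intro a ha b hb hab
  exact UpperHalfPlane.ext (hVo (hV' ha) (hV' hb) hab)

/-- quotient -/
abbrev QQ := MulAction.orbitRel.Quotient 𝒮ℒ ℍ

/-- projection -/
def prj (τ : ℍ) : QQ := Quotient.mk _ τ

/-- `j` on the quotient -/
def JQ : QQ → ℂ := Quotient.lift jH (by
  rintro a b ⟨γ, h⟩
  rw [← h]
  exact jH_smul' γ b)

lemma JQ_prj (τ : ℍ) : JQ (prj τ) = jH τ := rfl

lemma prj_surj (x : QQ) : ∃ τ, prj τ = x := Quotient.exists_rep x

lemma prj_cont : Continuous prj := continuous_quotient_mk'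

lemma prj_open : IsOpenMap prj := isOpenMap_quotient_mk'_mul (Γ := 𝒮ℒ)

lemma JQ_cont : Continuous JQ := Continuous.quotient_lift jH_cont _

lemma JQ_open : IsOpenMap JQ := by
  intro s hs
  have : JQ '' s = jH '' (prj ⁻¹' s) := by
    ext w
    constructor
    · rintro ⟨x, hx, rfl⟩
      obtain ⟨τ, rfl⟩ := prj_surj x
      exact ⟨τ, hx, rfl⟩
    · rintro ⟨τ, hx, rfl⟩
      exact ⟨prj τ, hx, rfl⟩
  rw [this]
  exact jH_open _ (hs.preimage prj_cont)

instance QQ_t2 : T2Space QQ := t2Space_of_properlyDiscontinuousSMul_of_t2Space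

lemma prj_eq {τ τ' : ℍ} : prj τ = prj τ' ↔ ∃ γ : SL(2, ℤ), γ • τ' = τ := by
  constructor
  · intro h
    obtain ⟨⟨γ, ⟨g, rfl⟩⟩, h⟩ := (Quotient.exact h : MulAction.orbitRel 𝒮ℒ ℍ τ τ')
    exact ⟨g, h⟩
  · rintro ⟨g, h⟩
    apply Quotient.sound
    exact ⟨⟨(g : GL (Fin 2) ℝ), ⟨g, rfl⟩⟩, h⟩

open ModularGroup in
lemma JQ_locinj (x : QQ) (h0 : JQ x ≠ 0) (h1 : JQ x ≠ 1728) : ∃ U : Set QQ, IsOpen U ∧ x ∈ U ∧ Set.InjOn JQ U := by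
  obtain ⟨τ, rfl⟩ := prj_surj x
  obtain ⟨U, hU, hm, hi⟩ := jH_locinj τ h0 h1
  refine ⟨prj '' U, prj_open U hU, ⟨τ, hm, rfl⟩, ?_⟩
  rintro _ ⟨a, ha, rfl⟩ _ ⟨b, hb, rfl⟩ hab
  rw [hi ha hb hab]

lemma JQ_compact (B : ℝ) : ∃ K : Set QQ, IsCompact K ∧ ∀ x, ‖JQ x‖ ≤ B → x ∈ K := by
  obtain ⟨y, hy⟩ := jH_large B
  refine ⟨prj '' (ModularGroup.truncatedFundamentalDomain y),
    (ModularGroup.isCompact_truncatedFundamentalDomain y).image prj_cont, ?_⟩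
  intro x hx
  obtain ⟨τ, rfl⟩ := prj_surj x
  obtain ⟨γ, hγ⟩ := ModularGroup.exists_smul_mem_fd τ
  have e : prj (γ • τ) = prj τ := prj_eq.2 ⟨γ, rfl⟩
  refine ⟨γ • τ, ⟨hγ, ?_⟩, e⟩
  by_contra hlt
  push Not at hlt
  have := hy _ hlt.le
  rw [← JQ_prj, e] at this
  linarith

/-- values with two preimages -/
def WW : Set ℂ := {w | ∃ x y, x ≠ y ∧ JQ x = w ∧ JQ y = w}

lemma WW_open : IsOpen WW := by
  rw [isOpen_iff_mem_nhds]
  rintro w ⟨x, y, hxy, hx, hy⟩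
  obtain ⟨U, V, hU, hV, hxU, hyV, hd⟩ := t2_separation hxy
  filter_upwards [(JQ_open U hU).mem_nhds ⟨x, hxU, hx⟩, (JQ_open V hV).mem_nhds ⟨y, hyV, hy⟩]
  rintro _ ⟨a, ha, rfl⟩ ⟨b, hb, hab⟩
  exact ⟨a, b, fun h => Set.disjoint_left.1 hd ha (h ▸ hb), rfl, hab⟩

lemma WW_closed {w : ℂ} (hw : w ∈ closure WW) (h0 : w ≠ 0) (h1 : w ≠ 1728) : w ∈ WW := by
  obtain ⟨K, hK, hKB⟩ := JQ_compact (‖w‖ + 1)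
  set A : Set (QQ × QQ) := {p | p ∈ K ×ˢ K ∧ p.1 ≠ p.2 ∧ JQ p.1 = JQ p.2} with hA
  have hcA : closure A ⊆ K ×ˢ K := closure_minimal (fun p hp => hp.1) (hK.isClosed.prod hK.isClosed)
  have hAc : IsCompact (closure A) := (hK.prod hK).of_isClosed_subset isClosed_closure hcA
  have hcl : IsClosed ((fun p : QQ × QQ => JQ p.1) '' closure A) :=
    (hAc.image (JQ_cont.comp continuous_fst)).isClosed
  have hmem : w ∈ closure ((fun p : QQ × QQ => JQ p.1) '' closure A) := by
    rw [mem_closure_iff_nhds] at hw ⊢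
    intro t ht
    obtain ⟨v, ⟨hv1, hv2⟩, x, y, hxy, hx, hy⟩ := hw (t ∩ Metric.ball w 1) (Filter.inter_mem ht (Metric.ball_mem_nhds _ one_pos))
    have hv3 : ‖v‖ ≤ ‖w‖ + 1 := by
      have := norm_le_norm_add_norm_sub' v w
      have h2 : ‖v - w‖ < 1 := by simpa [dist_eq_norm] using hv2
      linarith
    refine ⟨v, hv1, (x, y), subset_closure ⟨⟨hKB x (by rwa [hx]), hKB y (by rwa [hy])⟩, hxy, by simp [hx, hy]⟩, hx⟩
  rw [hcl.closure_eq] at hmem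
  obtain ⟨⟨x, y⟩, hxyA, hxw⟩ := hmem
  have heq : JQ x = JQ y := by
    have : closure A ⊆ {p : QQ × QQ | JQ p.1 = JQ p.2} :=
      closure_minimal (fun p hp => hp.2.2) (isClosed_eq (JQ_cont.comp continuous_fst) (JQ_cont.comp continuous_snd))
    exact this hxyA
  simp only at hxw
  by_cases hne : x = y
  · exfalso
    subst hne
    obtain ⟨U, hU, hxU, hi⟩ := JQ_locinj x (by rwa [hxw]) (by rwa [hxw])
    rw [mem_closure_iff_nhds] at hxyA
    obtain ⟨⟨a, b⟩, ⟨ha, hb⟩, -, hab, hj⟩ := hxyA (U ×ˢ U) ((hU.prod hU).mem_nhds ⟨hxU, hxU⟩)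
    exact hab (hi ha hb hj)
  · exact ⟨x, y, hne, hxw, heq ▸ hxw⟩

lemma qexp_eq_iff {z z' : ℂ} (h : qexp z = qexp z') : ∃ n : ℤ, z = z' + n := by
  rw [qexp, qexp, Complex.exp_eq_exp_iff_exists_int] at h
  obtain ⟨n, hn⟩ := h
  refine ⟨n, ?_⟩
  have := Complex.two_pi_I_ne_zero
  apply mul_left_cancel₀ this
  rw [hn]; ring

lemma WW_bdd : ∃ B : ℝ, ∀ w ∈ WW, ‖w‖ ≤ B := by
  have hd : HasStrictDerivAt (fun q => q / uu q) 1 0 := by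
    have han : AnalyticAt ℂ uu 0 := by
      have : DifferentiableOn ℂ uu (Metric.ball 0 1) := fun q hq =>
        (uu_diff (by simpa using hq)).differentiableWithinAt
      exact this.analyticAt (Metric.ball_mem_nhds _ one_pos)
    have := (hasStrictDerivAt_id (0:ℂ)).div han.hasStrictDerivAt (by simp [uu_zero])
    have h3 := this
    simp only [uu_zero, id, one_mul, zero_mul, sub_zero, one_pow, div_one] at h3
    exact h3
  obtain ⟨ε, hε, hinj⟩ : ∃ ε > 0, Set.InjOn (fun q => q / uu q) (Metric.ball 0 ε) := by
    set e := (hd.hasStrictFDerivAt_equiv one_ne_zero).toOpenPartialHomeomorph (fun q => q / uu q)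
    obtain ⟨ε, hε, h⟩ := Metric.mem_nhds_iff.1 (e.open_source.mem_nhds (HasStrictFDerivAt.mem_toOpenPartialHomeomorph_source _))
    exact ⟨ε, hε, e.injOn.mono h⟩
  have h4 : Tendsto (fun y : ℝ => Real.exp (-2 * π * y)) atTop (𝓝 0) := by
    apply Real.tendsto_exp_atBot.comp
    apply Filter.Tendsto.const_mul_atTop_of_neg _ tendsto_id
    nlinarith [Real.pi_pos]
  obtain ⟨y, hy⟩ := Filter.eventually_atTop.1 (h4.eventually (gt_mem_nhds hε))
  obtain ⟨B, hB⟩ := ((ModularGroup.isCompact_truncatedFundamentalDomain y).image jH_cont).isBounded.exists_norm_le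
  refine ⟨B, ?_⟩
  rintro w ⟨a, b, hab, ha, hb⟩
  by_contra hlt
  push Not at hlt
  have key : ∀ x : QQ, JQ x = w → ∃ τ, prj τ = x ∧ ‖qexp τ‖ < ε := by
    intro x hx
    obtain ⟨τ, rfl⟩ := prj_surj x
    obtain ⟨γ, hγ⟩ := ModularGroup.exists_smul_mem_fd τ
    have e : prj (γ • τ) = prj τ := prj_eq.2 ⟨γ, rfl⟩
    refine ⟨γ • τ, e, ?_⟩
    rw [norm_qexp]
    apply hy
    by_contra hc
    push Not at hc
    have := hB _ ⟨γ • τ, ⟨hγ, hc.le⟩, rfl⟩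
    rw [jH_smul, ← JQ_prj, hx] at this
    linarith
  obtain ⟨τ, rfl, h1⟩ := key a ha
  obtain ⟨τ', rfl, h1'⟩ := key b hb
  have h2 : qexp τ = qexp τ' := by
    apply hinj (by simpa using h1) (by simpa using h1')
    rw [← hb, JQ_prj, JQ_prj, jH, jH, jinv_eq_uu τ.2, jinv_eq_uu τ'.2] at ha
    have := congrArg (·⁻¹) ha
    simpa [inv_div] using this
  obtain ⟨n, hn⟩ := qexp_eq_iff h2
  apply hab
  refine prj_eq.2 ⟨ModularGroup.T ^ n, ?_⟩
  apply UpperHalfPlane.ext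
  rw [ModularGroup.coe_T_zpow_smul_eq, hn]

lemma WW_empty : WW = ∅ := by
  obtain ⟨B, hB⟩ := WW_bdd
  have hcount : (({0, 1728} : Set ℂ)).Countable := (Set.toFinite _).countable
  have hpre : IsPreconnected (({0, 1728} : Set ℂ)ᶜ) :=
    (hcount.isPathConnected_compl_of_one_lt_rank (by rw [Complex.rank_real_complex]; norm_num)).isConnected.isPreconnected
  have hsub : WW ⊆ {0, 1728} := by
    by_contra hns
    obtain ⟨w, hw, hw2⟩ := Set.not_subset.1 hns
    have := hpre.subset_of_closure_inter_subset WW_open ⟨w, hw2, hw⟩ (by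
      rintro v ⟨hv, hv2⟩
      simp only [Set.mem_compl_iff, Set.mem_insert_iff, Set.mem_singleton_iff, not_or] at hv2
      exact WW_closed hv hv2.1 hv2.2)
    have h1 : (((|B| + 2000 : ℝ)) : ℂ) ∈ WW := by
      apply this
      have hB0 := abs_nonneg B
      simp only [Set.mem_compl_iff, Set.mem_insert_iff, Set.mem_singleton_iff, not_or]
      constructor
      · intro h
        have h' : |B| + 2000 = 0 := by exact_mod_cast h
        linarith
      · intro h
        have h' : |B| + 2000 = 1728 := by exact_mod_cast h
        linarith
    have h2 := hB _ h1
    rw [Complex.norm_real, Real.norm_of_nonneg (by positivity)] at h2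
    linarith [le_abs_self B]
  by_contra hne
  obtain ⟨w, hw⟩ := Set.nonempty_iff_ne_empty.2 hne
  have hinf : WW.Infinite := infinite_of_mem_nhds w (WW_open.mem_nhds hw)
  exact hinf ((Set.toFinite _).subset hsub)

lemma jH_inj {τ τ' : ℍ} (h : jH τ = jH τ') : ∃ γ : SL(2, ℤ), γ • τ = τ' := by
  by_contra hc
  have : jH τ ∈ WW := ⟨prj τ', prj τ, fun h => hc (prj_eq.1 h), h.symm, rfl⟩
  rw [WW_empty] at this
  exact this

end

section
set_option autoImplicit false

open scoped ComplexConjugate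

/-- point on the arc -/
def zt (θ : ℝ) : ℂ := Complex.exp (θ * I)

lemma zt_re (θ : ℝ) : (zt θ).re = Real.cos θ := Complex.exp_ofReal_mul_I_re θ
lemma zt_im (θ : ℝ) : (zt θ).im = Real.sin θ := Complex.exp_ofReal_mul_I_im θ
lemma zt_norm (θ : ℝ) : ‖zt θ‖ = 1 := Complex.norm_exp_ofReal_mul_I θ
lemma zt_ne (θ : ℝ) : zt θ ≠ 0 := Complex.exp_ne_zero _
lemma zt_conj (θ : ℝ) : -1 / zt θ = - conj (zt θ) := by
  have h : zt θ * conj (zt θ) = 1 := by rw [Complex.mul_conj, Complex.normSq_eq_norm_sq, zt_norm]; simp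
  have := zt_ne θ
  field_simp
  rw [h]

lemma qexp_conj (z : ℂ) : qexp (- conj z) = conj (qexp z) := by
  have h2 : conj (2:ℂ) = 2 := Complex.conj_ofNat 2
  rw [qexp, qexp, ← Complex.exp_conj]
  congr 1
  simp [h2]

lemma Eis_conj (k : ℕ) (z : ℂ) : Eis k (- conj z) = conj (Eis k z) := by
  unfold Eis
  split_ifs with h
  · simp
  · rw [map_mul, Complex.conj_tsum]
    congr 1
    · have h2 : conj (2:ℂ) = 2 := Complex.conj_ofNat 2
      simp [h2]
    · let e : ℤ × ℤ ≃ ℤ × ℤ := (Equiv.neg ℤ).prodCongr (Equiv.refl ℤ)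
      rw [← e.tsum_eq]
      refine tsum_congr fun p => ?_
      have h1 : (e p).1 = - p.1 := rfl
      have h2 : (e p).2 = p.2 := rfl
      rw [h1, h2, Int.neg_gcd]
      split_ifs with h3
      · simp
      · simp

lemma conj_im_pos {z : ℂ} (hz : 0 < z.im) : 0 < (- conj z).im := by simpa using hz

lemma ec_conj {k : ℕ} (hk : k = 0 ∨ 3 ≤ k) {q : ℂ} (hq : ‖q‖ < 1) (h0 : q ≠ 0) : ec k (conj q) = conj (ec k q) := by
  obtain ⟨z, hz, rfl⟩ := qexp_surj h0 hq
  rw [← qexp_conj, ec_qexp hk hz, ec_qexp hk (conj_im_pos hz), Eis_conj]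

lemma dd_conj {q : ℂ} (hq : ‖q‖ < 1) (h0 : q ≠ 0) : dd (conj q) = conj (dd q) := by
  have h1 := ec_E6 hq
  have h2 := ec_E6 (q := conj q) (by simpa using hq)
  rw [ec_conj (by norm_num) hq h0, ec_conj (by norm_num) hq h0] at h2
  have h3 := congrArg conj h1
  simp only [map_sub, map_pow, map_mul] at h3
  rw [h3] at h2
  have h4 : conj q ≠ 0 := by simpa using h0
  have h5 : conj (1728 : ℂ) = 1728 := Complex.conj_ofNat 1728
  rw [h5] at h2
  exact (mul_left_cancel₀ h4 (mul_left_cancel₀ (by norm_num) h2)).symm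

lemma uu_conj {q : ℂ} (hq : ‖q‖ < 1) (h0 : q ≠ 0) : uu (conj q) = conj (uu q) := by
  rw [uu, uu, dd_conj hq h0, ec_conj (by norm_num) hq h0, map_div₀, map_pow]

lemma jinv_conj {z : ℂ} (hz : 0 < z.im) : jinv (- conj z) = conj (jinv z) := by
  rw [jinv_eq_uu hz, jinv_eq_uu (conj_im_pos hz), qexp_conj, uu_conj (norm_qexp_lt_one hz) (qexp_ne_zero _), map_div₀]

lemma arc_sin_pos {θ : ℝ} (h : θ ∈ Set.Icc (π / 2) (2 * π / 3)) : 0 < Real.sin θ := by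
  have := Real.pi_pos
  exact Real.sin_pos_of_pos_of_lt_pi (by linarith [h.1]) (by linarith [h.2])

lemma zt_im_pos {θ : ℝ} (h : θ ∈ Set.Icc (π / 2) (2 * π / 3)) : 0 < (zt θ).im := by
  rw [zt_im]; exact arc_sin_pos h

lemma jinv_arc_real {θ : ℝ} (h : θ ∈ Set.Icc (π / 2) (2 * π / 3)) : jinv (zt θ) = ((jinv (zt θ)).re : ℂ) := by
  have h1 := jinv_conj (zt_im_pos h)
  rw [← zt_conj, jinv_S (zt_im_pos h)] at h1
  exact (Complex.conj_eq_iff_re.1 h1.symm).symm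

/-- `j` on the arc as a real function -/
def gj (θ : ℝ) : ℝ := (jinv (zt θ)).re

lemma gj_coe {θ : ℝ} (h : θ ∈ Set.Icc (π / 2) (2 * π / 3)) : jinv (zt θ) = (gj θ : ℂ) := jinv_arc_real h

lemma gj_contOn : ContinuousOn gj (Set.Icc (π / 2) (2 * π / 3)) := by
  intro θ h
  have h1 : ContinuousAt zt θ := by unfold zt; fun_prop
  have h2 : ContinuousAt (fun θ => jinv (zt θ)) θ := ContinuousAt.comp (jinv_analytic (zt_im_pos h)).continuousAt h1
  exact (Complex.continuous_re.continuousAt.comp h2).continuousWithinAt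

lemma cos_two_pi_div_three : Real.cos (2 * π / 3) = -1 / 2 := by
  have : 2 * π / 3 = π - π / 3 := by ring
  rw [this, Real.cos_pi_sub, Real.cos_pi_div_three]; norm_num

lemma sin_two_pi_div_three : Real.sin (2 * π / 3) = √3 / 2 := by
  have : 2 * π / 3 = π - π / 3 := by ring
  rw [this, Real.sin_pi_sub, Real.sin_pi_div_three]

lemma gj_left : gj (π / 2) = 1728 := by
  have hz : zt (π / 2) = I := by
    apply Complex.ext
    · rw [zt_re]; simp
    · rw [zt_im]; simp
  have him : 0 < (I : ℂ).im := by simp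
  have h1 := ec_S (k := 6) (by norm_num) him
  have h2 : -1 / I = I := by
    rw [div_eq_iff Complex.I_ne_zero, Complex.I_mul_I]
  have h3 : I ^ 6 = -1 := by
    rw [show (6:ℕ) = 2 * 3 by norm_num, pow_mul, Complex.I_sq]; norm_num
  rw [h2, h3] at h1
  have h4 : ec 6 (qexp I) = 0 := by linear_combination (1/2) * h1
  have h5 := jinv_sub him
  rw [h4] at h5
  rw [gj, hz, show jinv I = 1728 by simpa [sub_eq_zero] using h5]
  norm_num

lemma gj_right : gj (2 * π / 3) = 0 := by
  have hmem : 2 * π / 3 ∈ Set.Icc (π / 2) (2 * π / 3) := ⟨by linarith [Real.pi_pos], le_rfl⟩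
  have him := zt_im_pos hmem
  set z := zt (2 * π / 3) with hz
  have hz3 : z ^ 3 = 1 := by
    rw [hz, zt, ← Complex.exp_nat_mul]
    rw [show ((3:ℕ) : ℂ) * (((2 * π / 3 : ℝ) : ℂ) * I) = 2 * π * I by push_cast; ring, Complex.exp_two_pi_mul_I]
  have hz1 : z ≠ 1 := by
    intro h
    rw [h] at him; simp at him
  have hq : z ^ 2 + z + 1 = 0 := by
    have : (z - 1) * (z ^ 2 + z + 1) = 0 := by linear_combination hz3
    exact (mul_eq_zero.1 this).resolve_left (sub_ne_zero.2 hz1)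
  have h2 : -1 / z = z + 1 := by
    rw [div_eq_iff (zt_ne _)]; linear_combination -hq
  have h1 := Eis_S (k := 4) (by norm_num) him
  rw [h2, Eis_T (by norm_num) him] at h1
  have h3 : (1 - z) * Eis 4 z = 0 := by linear_combination h1 + Eis 4 z * z * hz3
  have h4 : Eis 4 z = 0 := (mul_eq_zero.1 h3).resolve_left (sub_ne_zero.2 (Ne.symm hz1))
  rw [gj, ← hz, jinv, h4]; simp

lemma arc_cos {θ : ℝ} (h : θ ∈ Set.Icc (π / 2) (2 * π / 3)) : -1 / 2 ≤ Real.cos θ ∧ Real.cos θ ≤ 0 := by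
  have hp := Real.pi_pos
  constructor
  · rw [← cos_two_pi_div_three]
    exact Real.cos_le_cos_of_nonneg_of_le_pi (by linarith [h.1]) (by linarith) h.2
  · rw [← Real.cos_pi_div_two]
    exact Real.cos_le_cos_of_nonneg_of_le_pi (by linarith) (by linarith [h.2]) h.1

lemma arc_cos_lt {θ : ℝ} (h : θ ∈ Set.Ioo (π / 2) (2 * π / 3)) : -1 / 2 < Real.cos θ ∧ Real.cos θ < 0 := by
  have hp := Real.pi_pos
  constructor
  · rw [← cos_two_pi_div_three]
    exact Real.cos_lt_cos_of_nonneg_of_le_pi (by linarith [h.1]) (by linarith) h.2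
  · rw [← Real.cos_pi_div_two]
    exact Real.cos_lt_cos_of_nonneg_of_le_pi (by linarith) (by linarith [h.2]) h.1

lemma int_form_ge (c d : ℤ) (hcd : c ≠ 0 ∨ d ≠ 0) : (1:ℤ) ≤ c ^ 2 - |c * d| + d ^ 2 := by
  rcases abs_cases (c * d) with ⟨h, _⟩ | ⟨h, _⟩ <;> rw [h]
  · by_contra hlt
    have : c ^ 2 - c * d + d ^ 2 ≤ 0 := by omega
    have hc : c ^ 2 = 0 := by nlinarith [sq_nonneg (c - 2 * d), sq_nonneg (c - d), sq_nonneg c, sq_nonneg d]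
    have hd : d ^ 2 = 0 := by nlinarith [sq_nonneg (2 * c - d), sq_nonneg (c - d), sq_nonneg c, sq_nonneg d]
    simp at hc hd
    omega
  · by_contra hlt
    have : c ^ 2 + c * d + d ^ 2 ≤ 0 := by omega
    have hc : c ^ 2 = 0 := by nlinarith [sq_nonneg (c + 2 * d), sq_nonneg (c + d), sq_nonneg c, sq_nonneg d]
    have hd : d ^ 2 = 0 := by nlinarith [sq_nonneg (2 * c + d), sq_nonneg (c + d), sq_nonneg c, sq_nonneg d]
    simp at hc hd
    omega

open UpperHalfPlane MatrixGroups in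
/-- orbit description -/
lemma orbit {z τ : ℂ} (hz : 0 < z.im) (hτ : 0 < τ.im) (h : jinv τ = jinv z) :
    ∃ a b c d : ℤ, a * d - b * c = 1 ∧ τ * (c * z + d) = a * z + b ∧ τ.im * Complex.normSq (c * z + d) = z.im := by
  obtain ⟨γ, hγ⟩ := jH_inj (τ := ⟨z, hz⟩) (τ' := ⟨τ, hτ⟩) h.symm
  refine ⟨γ 0 0, γ 0 1, γ 1 0, γ 1 1, ?_, ?_, ?_⟩
  · have := γ.det_coe
    rw [Matrix.det_fin_two] at this
    exact this
  · have h1 := congrArg ((↑) : ℍ → ℂ) hγ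
    rw [UpperHalfPlane.coe_specialLinearGroup_apply] at h1
    simp only [algebraMap_int_eq, Int.coe_castRingHom] at h1
    rw [← h1]
    have hne : ((γ 1 0 : ℤ) : ℂ) * z + ((γ 1 1 : ℤ) : ℂ) ≠ 0 := by
      have := UpperHalfPlane.denom_ne_zero (γ : GL (Fin 2) ℝ) ⟨z, hz⟩
      rw [ModularGroup.denom_apply] at this
      exact this
    push_cast
    rw [div_mul_cancel₀]
    exact hne
  · have h1 := congrArg UpperHalfPlane.im hγ
    rw [ModularGroup.im_smul_eq_div_normSq, ModularGroup.denom_apply] at h1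
    have hne : ((γ 1 0 : ℤ) : ℂ) * z + ((γ 1 1 : ℤ) : ℂ) ≠ 0 := by
      have := UpperHalfPlane.denom_ne_zero (γ : GL (Fin 2) ℝ) ⟨z, hz⟩
      rw [ModularGroup.denom_apply] at this
      exact this
    have h2 : 0 < Complex.normSq (((γ 1 0 : ℤ) : ℂ) * z + ((γ 1 1 : ℤ) : ℂ)) := Complex.normSq_pos.2 hne
    have h3 : τ.im = z.im / Complex.normSq (((γ 1 0 : ℤ) : ℂ) * z + ((γ 1 1 : ℤ) : ℂ)) := h1.symm
    rw [h3]
    field_simp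

lemma normSq_form (θ : ℝ) (c d : ℤ) : Complex.normSq (c * zt θ + d) = c ^ 2 + 2 * (c * d) * Real.cos θ + d ^ 2 := by
  rw [Complex.normSq_apply]
  simp only [add_re, add_im, mul_re, mul_im, intCast_re, intCast_im, zt_re, zt_im]
  have := Real.sin_sq_add_cos_sq θ
  linear_combination (c:ℝ)^2 * this

lemma normSq_ge {θ : ℝ} (h : θ ∈ Set.Icc (π / 2) (2 * π / 3)) (c d : ℤ) :
    (c:ℝ) ^ 2 - |(c:ℝ) * d| + d ^ 2 ≤ Complex.normSq (c * zt θ + d) := by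
  rw [normSq_form]
  obtain ⟨h1, h2⟩ := arc_cos h
  rcases abs_cases ((c:ℝ) * d) with ⟨h, _⟩ | ⟨h, _⟩ <;> rw [h] <;> nlinarith

lemma im_le_of_orbit {θ : ℝ} (h : θ ∈ Set.Icc (π / 2) (2 * π / 3)) {τ : ℂ} (hτ : 0 < τ.im) (hj : jinv τ = jinv (zt θ)) :
    τ.im ≤ (zt θ).im := by
  obtain ⟨a, b, c, d, hdet, -, him⟩ := orbit (zt_im_pos h) hτ hj
  have h1 := int_form_ge c d (by
    by_contra hc
    push Not at hc
    rw [hc.1, hc.2] at hdet; simp at hdet)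
  have h2 := normSq_ge h c d
  have h3 : (1:ℝ) ≤ (c:ℝ) ^ 2 - |(c:ℝ) * d| + d ^ 2 := by exact_mod_cast h1
  rw [← him]
  nlinarith

lemma gj_injOn : Set.InjOn gj (Set.Icc (π / 2) (2 * π / 3)) := by
  intro a ha b hb hab
  have h1 : jinv (zt a) = jinv (zt b) := by rw [gj_coe ha, gj_coe hb, hab]
  have h2 := im_le_of_orbit hb (zt_im_pos ha) h1
  have h3 := im_le_of_orbit ha (zt_im_pos hb) h1.symm
  rw [zt_im, zt_im] at h2 h3
  have hs : Real.sin a = Real.sin b := le_antisymm h2 h3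
  have hc : Real.cos a = Real.cos b := by
    have e1 := Real.sin_sq_add_cos_sq a
    have e2 := Real.sin_sq_add_cos_sq b
    rw [hs] at e1
    have e3 : Real.cos a ^ 2 = Real.cos b ^ 2 := by linarith
    rcases sq_eq_sq_iff_eq_or_eq_neg.1 e3 with h | h
    · exact h
    · have := (arc_cos ha).2
      have := (arc_cos hb).2
      linarith
  have hp := Real.pi_pos
  exact Real.injOn_cos ⟨by linarith [ha.1], by linarith [ha.2]⟩ ⟨by linarith [hb.1], by linarith [hb.2]⟩ hc

lemma gj_anti : StrictAntiOn gj (Set.Icc (π / 2) (2 * π / 3)) := by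
  have hp := Real.pi_pos
  apply ContinuousOn.strictAntiOn_of_injOn_Icc (by linarith) _ gj_contOn gj_injOn
  rw [gj_left, gj_right]; norm_num

lemma gj_mem {θ : ℝ} (h : θ ∈ Set.Ioo (π / 2) (2 * π / 3)) : 0 < gj θ ∧ gj θ < 1728 := by
  have hp := Real.pi_pos
  have hm := Set.Ioo_subset_Icc_self h
  constructor
  · rw [← gj_right]; exact gj_anti hm ⟨by linarith, le_rfl⟩ h.2
  · rw [← gj_left]; exact gj_anti ⟨le_rfl, by linarith⟩ hm h.1

end

section
set_option autoImplicit false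

open scoped ComplexConjugate

lemma qexp_of_sub {τ z : ℂ} (n : ℤ) (h : τ = z + n) : qexp τ = qexp z := by rw [h, qexp_add_int]

lemma enum3 {θ : ℝ} (h : θ ∈ Set.Icc (π / 2) (2 * π / 3)) {τ : ℂ} (hτ : 2 / 3 ≤ τ.im) (hj : jinv τ = jinv (zt θ)) :
    qexp τ = qexp (zt θ) ∨ qexp τ = qexp (-1 / zt θ) ∨
      (qexp τ = qexp (-1 / (zt θ + 1)) ∧ τ.im * (2 + 2 * Real.cos θ) = Real.sin θ) := by
  obtain ⟨a, b, c, d, hdet, heq, him⟩ := orbit (zt_im_pos h) (by linarith) hj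
  have hz0 := zt_ne θ
  have hz1 : zt θ + 1 ≠ 0 := by
    intro h0
    have := congrArg Complex.im h0
    have h2 := zt_im_pos h
    simp at this; linarith
  have h2 := normSq_ge h c d
  rw [zt_im] at him
  have hs := Real.sin_le_one θ
  have h3 : (c:ℝ) ^ 2 - |(c:ℝ) * d| + d ^ 2 ≤ 3 / 2 := by nlinarith [Complex.normSq_nonneg (c * zt θ + d)]
  have h4 : c ^ 2 - |c * d| + d ^ 2 ≤ 1 := by
    have : ((c ^ 2 - |c * d| + d ^ 2 : ℤ) : ℝ) < 2 := by push_cast; linarith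
    have : c ^ 2 - |c * d| + d ^ 2 < 2 := by exact_mod_cast this
    linarith
  have h5 : c ^ 2 + d ^ 2 ≤ 2 := by
    rcases abs_cases (c * d) with ⟨e, _⟩ | ⟨e, _⟩ <;> rw [e] at h4 <;> nlinarith [sq_nonneg (c + d), sq_nonneg (c - d)]
  have hc1 : c ≤ 1 := by nlinarith [sq_nonneg d]
  have hc2 : -1 ≤ c := by nlinarith [sq_nonneg d]
  have hd1 : d ≤ 1 := by nlinarith [sq_nonneg c]
  have hd2 : -1 ≤ d := by nlinarith [sq_nonneg c]
  obtain ⟨hcos1, hcos2⟩ := arc_cos h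
  rw [normSq_form] at him
  interval_cases c <;> interval_cases d
  · right; right
    refine ⟨qexp_of_sub (-a) ?_, ?_⟩
    · have : b = a + 1 := by linarith
      subst this
      push_cast at heq ⊢
      field_simp
      linear_combination -heq
    · push_cast at him; linarith
  · right; left
    refine qexp_of_sub (-a) ?_
    have : b = 1 := by linarith
    subst this
    push_cast at heq ⊢
    field_simp
    linear_combination -heq
  · exfalso
    push_cast at him
    nlinarith
  · left
    have : a = -1 := by linarith
    subst this
    refine qexp_of_sub (-b) ?_
    push_cast at heq ⊢
    linear_combination -heq
  · simp at hdet
  · left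
    have : a = 1 := by linarith
    subst this
    refine qexp_of_sub (b) ?_
    push_cast at heq ⊢
    linear_combination heq
  · exfalso
    push_cast at him
    nlinarith
  · right; left
    refine qexp_of_sub (a) ?_
    have : b = -1 := by linarith
    subst this
    push_cast at heq ⊢
    field_simp
    linear_combination heq
  · right; right
    refine ⟨qexp_of_sub (a) ?_, ?_⟩
    · have : b = a - 1 := by linarith
      subst this
      push_cast at heq ⊢
      field_simp
      linear_combination heq
    · push_cast at him; linarith

lemma enum2 {θ : ℝ} (h : θ ∈ Set.Icc (π / 2) (2 * π / 3)) (hc : -1 / 3 ≤ Real.cos θ) {τ : ℂ} (hτ : 3 / 4 ≤ τ.im) (hj : jinv τ = jinv (zt θ)) :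
    qexp τ = qexp (zt θ) ∨ qexp τ = qexp (-1 / zt θ) := by
  rcases enum3 h (by linarith) hj with h1 | h1 | ⟨-, h1⟩
  · exact Or.inl h1
  · exact Or.inr h1
  · exfalso
    have h2 := Real.sin_sq_add_cos_sq θ
    have h3 := Real.sin_le_one θ
    have h4 := (arc_cos h).2
    have h5 : 3 / 4 * (2 + 2 * Real.cos θ) ≤ Real.sin θ := by rw [← h1]; gcongr; linarith
    have h6 : Real.sin θ = 1 := by linarith
    have h7 : Real.cos θ = 0 := by rw [h6] at h2; nlinarith
    linarith

lemma arc_add_ne {θ : ℝ} (h : θ ∈ Set.Icc (π / 2) (2 * π / 3)) : zt θ + 1 ≠ 0 := by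
  intro h0
  have := congrArg Complex.im h0
  have h2 := zt_im_pos h
  simp at this; linarith

lemma z3_im {θ : ℝ} : (-1 / (zt θ + 1)).im = Real.sin θ / (2 + 2 * Real.cos θ) := by
  have e : Complex.normSq (zt θ + 1) = 2 + 2 * Real.cos θ := by
    have := normSq_form θ 1 1
    push_cast at this
    rw [one_mul] at this
    rw [this]; ring
  rw [neg_div, one_div, Complex.neg_im, Complex.inv_im, e]
  simp only [add_im, one_im, zt_im]; ring

lemma z3_im_ge {θ : ℝ} (h : θ ∈ Set.Icc (π / 2) (2 * π / 3)) (hc : Real.cos θ ≤ -1 / 3) : 2 / 3 < (-1 / (zt θ + 1)).im := by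
  rw [z3_im]
  have h1 := (arc_cos h).1
  rw [lt_div_iff₀ (by linarith)]
  have h2 := Real.sin_sq_add_cos_sq θ
  have h3 := arc_sin_pos h
  nlinarith

lemma jinv_z3 {θ : ℝ} (h : θ ∈ Set.Icc (π / 2) (2 * π / 3)) : jinv (-1 / (zt θ + 1)) = jinv (zt θ) := by
  have := zt_im_pos h
  rw [jinv_S (by simpa using this), jinv_T this]

lemma arc_sin_ge {θ : ℝ} (h : θ ∈ Set.Icc (π / 2) (2 * π / 3)) : √3 / 2 ≤ Real.sin θ := by
  have h2 := Real.sin_sq_add_cos_sq θ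
  have h3 := arc_sin_pos h
  obtain ⟨h4, h5⟩ := arc_cos h
  have : √3 / 2 ≤ √(Real.sin θ ^ 2) := by
    rw [show √3 / 2 = √(3 / 4) by
      rw [Real.sqrt_div (by norm_num), show (4:ℝ) = 2 ^ 2 by norm_num, Real.sqrt_sq (by norm_num)]]
    apply Real.sqrt_le_sqrt
    nlinarith
  rwa [Real.sqrt_sq h3.le] at this

lemma sqrt3_gt : (1.732:ℝ) < √3 := by
  apply Real.lt_sqrt_of_sq_lt; norm_num

lemma qexp_ne_S {θ : ℝ} (h : θ ∈ Set.Ioo (π / 2) (2 * π / 3)) : qexp (zt θ) ≠ qexp (-1 / zt θ) := by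
  intro he
  obtain ⟨n, hn⟩ := qexp_eq_iff he
  rw [zt_conj] at hn
  have h1 := congrArg Complex.re hn
  simp [zt_re] at h1
  obtain ⟨h2, h3⟩ := arc_cos_lt h
  have h4 : (n:ℝ) < 0 := by linarith
  have h5 : (-1:ℝ) < n := by linarith
  have h6 : n < 0 := by exact_mod_cast h4
  have h7 : -1 < n := by exact_mod_cast h5
  omega

lemma z3_im_lt {θ : ℝ} (h : θ ∈ Set.Ioo (π / 2) (2 * π / 3)) : (-1 / (zt θ + 1)).im < Real.sin θ := by
  obtain ⟨h2, h3⟩ := arc_cos_lt h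
  rw [z3_im, div_lt_iff₀ (by linarith)]
  have := arc_sin_pos (Set.Ioo_subset_Icc_self h)
  nlinarith

lemma norm_qexp_lt_iff {z w : ℂ} (h : z.im < w.im) : ‖qexp w‖ < ‖qexp z‖ := by
  rw [norm_qexp, norm_qexp, Real.exp_lt_exp]
  nlinarith [Real.pi_pos]

lemma root_cond {θ : ℝ} (h : θ ∈ Set.Ioo (π / 2) (2 * π / 3)) {τ : ℂ} (hτ : 0 < τ.im) (hj : jinv τ = jinv (zt θ)) :
    uu (qexp τ) = (gj θ : ℂ) * qexp τ ∧ ec 14 (qexp τ) ≠ 0 := by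
  obtain ⟨h1, h2⟩ := gj_mem h
  have hg := gj_coe (Set.Ioo_subset_Icc_self h)
  rw [hg] at hj
  constructor
  · rw [← hj, jinv_eq_uu hτ, div_mul_cancel₀ _ (qexp_ne_zero _)]
  · apply ec14_ne hτ <;> rw [hj]
    · exact_mod_cast h1.ne'
    · exact_mod_cast h2.ne

lemma root_conv {θ : ℝ} (h : θ ∈ Set.Icc (π / 2) (2 * π / 3)) {q : ℂ} {A : ℝ} (hA : 0 < A) (hq : ‖q‖ ≤ Real.exp (-2 * π * A))
    (hj : uu q = (gj θ : ℂ) * q) : ∃ τ : ℂ, A ≤ τ.im ∧ jinv τ = jinv (zt θ) ∧ q = qexp τ := by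
  have h0 : q ≠ 0 := by
    rintro rfl
    rw [uu_zero] at hj; simp at hj
  have h1 : ‖q‖ < 1 := hq.trans_lt (by
    apply Real.exp_lt_one_iff.2; nlinarith [mul_pos Real.pi_pos hA])
  obtain ⟨τ, hτ, rfl⟩ := qexp_surj h0 h1
  refine ⟨τ, ?_, ?_, rfl⟩
  · rw [norm_qexp, Real.exp_le_exp] at hq
    nlinarith [Real.pi_pos]
  · rw [jinv_eq_uu hτ, hj, gj_coe h, mul_div_cancel_right₀ _ h0]

/-- residue term -/
def TT (ℓ k' m : ℕ) (p : ℂ) : ℂ := p ^ m / ((p * dd p) ^ ℓ * ec k' p)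

lemma formula2 {ℓ k' m : ℕ} (hk' : k' = 0 ∨ k' = 4 ∨ k' = 6 ∨ k' = 8 ∨ k' = 10 ∨ k' = 14) (hm : m ≤ ℓ)
    {f : ℂ → ℂ} {F : Polynomial ℂ} (hf : IsMillerForm ℓ k' m f) (hF : IsFaber ℓ k' m f F)
    {θ : ℝ} (h : θ ∈ Set.Ioo (π / 2) (2 * π / 3)) (hc : -1 / 3 ≤ Real.cos θ) :
    F.eval (gj θ : ℂ) = TT ℓ k' m (qexp (zt θ)) + TT ℓ k' m (qexp (-1 / zt θ)) +
      (2 * π * I)⁻¹ * ∮ q in C(0, Real.exp (-2 * π * (3 / 4))), VV ℓ k' m q / (uu q - (gj θ : ℂ) * q) := by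
  classical
  have h' := Set.Ioo_subset_Icc_self h
  have hs := arc_sin_ge h'
  have hs3 := sqrt3_gt
  have hz := zt_im_pos h'
  rw [formula hk' hm hf hF (gj θ) (r := Real.exp (-2 * π * (3 / 4))) (Real.exp_pos _) (by
    apply Real.exp_lt_one_iff.2; nlinarith [Real.pi_pos]) {qexp (zt θ), qexp (-1 / zt θ)}, Finset.sum_pair (qexp_ne_S h)]
  · rfl
  · intro p hp
    have key : ∀ τ : ℂ, 3 / 4 < τ.im → jinv τ = jinv (zt θ) → ‖qexp τ‖ < Real.exp (-2 * π * (3 / 4)) ∧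
      uu (qexp τ) = gj θ * (qexp τ) ∧ ec 14 (qexp τ) ≠ 0 := by
      intro τ h1 h2
      refine ⟨?_, root_cond h (by linarith) h2⟩
      rw [norm_qexp, Real.exp_lt_exp]; nlinarith [Real.pi_pos]
    simp only [Finset.mem_insert, Finset.mem_singleton] at hp
    rcases hp with rfl | rfl
    · exact key _ (by rw [zt_im]; linarith) rfl
    · refine key _ ?_ (jinv_S hz)
      rw [zt_conj]; simp [zt_im]; linarith
  · intro q hq hu
    obtain ⟨τ, h1, h2, rfl⟩ := root_conv h' (by norm_num) hq hu
    simp only [Finset.mem_insert, Finset.mem_singleton]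
    exact enum2 h' hc h1 h2

lemma formula3 {ℓ k' m : ℕ} (hk' : k' = 0 ∨ k' = 4 ∨ k' = 6 ∨ k' = 8 ∨ k' = 10 ∨ k' = 14) (hm : m ≤ ℓ)
    {f : ℂ → ℂ} {F : Polynomial ℂ} (hf : IsMillerForm ℓ k' m f) (hF : IsFaber ℓ k' m f F)
    {θ : ℝ} (h : θ ∈ Set.Ioo (π / 2) (2 * π / 3)) (hc : Real.cos θ ≤ -1 / 3) :
    F.eval (gj θ : ℂ) = TT ℓ k' m (qexp (zt θ)) + TT ℓ k' m (qexp (-1 / zt θ)) + TT ℓ k' m (qexp (-1 / (zt θ + 1))) +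
      (2 * π * I)⁻¹ * ∮ q in C(0, Real.exp (-2 * π * (2 / 3))), VV ℓ k' m q / (uu q - (gj θ : ℂ) * q) := by
  classical
  have h' := Set.Ioo_subset_Icc_self h
  have hs := arc_sin_ge h'
  have hs3 := sqrt3_gt
  have hz := zt_im_pos h'
  have hSim : (-1 / zt θ).im = Real.sin θ := by rw [zt_conj]; simp [zt_im]
  have hlt := z3_im_lt h
  rw [formula hk' hm hf hF (gj θ) (r := Real.exp (-2 * π * (2 / 3))) (Real.exp_pos _) (by
    apply Real.exp_lt_one_iff.2; nlinarith [Real.pi_pos]) {qexp (zt θ), qexp (-1 / zt θ), qexp (-1 / (zt θ + 1))},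
      Finset.sum_insert, Finset.sum_pair]
  · rw [← add_assoc]; rfl
  · intro he
    have := norm_qexp_lt_iff (z := (-1 / (zt θ + 1))) (w := -1 / zt θ) (by rwa [hSim])
    rw [he] at this
    exact lt_irrefl _ this
  · simp only [Finset.mem_insert, Finset.mem_singleton, not_or]
    refine ⟨qexp_ne_S h, fun he => ?_⟩
    have := norm_qexp_lt_iff (z := (-1 / (zt θ + 1))) (w := zt θ) (by rwa [zt_im])
    rw [he] at this
    exact lt_irrefl _ this
  · intro p hp
    have key : ∀ τ : ℂ, 2 / 3 < τ.im → jinv τ = jinv (zt θ) → ‖qexp τ‖ < Real.exp (-2 * π * (2 / 3)) ∧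
      uu (qexp τ) = gj θ * (qexp τ) ∧ ec 14 (qexp τ) ≠ 0 := by
      intro τ h1 h2
      refine ⟨?_, root_cond h (by linarith) h2⟩
      rw [norm_qexp, Real.exp_lt_exp]; nlinarith [Real.pi_pos]
    simp only [Finset.mem_insert, Finset.mem_singleton] at hp
    rcases hp with rfl | rfl | rfl
    · exact key _ (by rw [zt_im]; linarith) rfl
    · refine key _ ?_ (jinv_S hz)
      rw [hSim]; linarith
    · exact key _ (z3_im_ge h' hc) (jinv_z3 h')
  · intro q hq hu
    obtain ⟨τ, h1, h2, rfl⟩ := root_conv h' (by norm_num) hq hu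
    simp only [Finset.mem_insert, Finset.mem_singleton]
    rcases enum3 h' h1 h2 with h3 | h3 | ⟨h3, -⟩
    · exact Or.inl h3
    · exact Or.inr (Or.inl h3)
    · exact Or.inr (Or.inr h3)

end

section
set_option autoImplicit false

open scoped ComplexConjugate

lemma dd_tendsto {q : ℂ} (hq : ‖q‖ < 1) :
    Tendsto (fun N => ∏ i ∈ Finset.range N, (1 - q ^ (i + 1)) ^ 24) atTop (𝓝 (dd q)) := by
  have h : Multipliable (fun n : ℕ => (1 - q ^ (n + 1)) ^ 24) := by
    have h1 : Multipliable (fun n : ℕ => 1 + (- q ^ (n + 1))) := by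
      apply multipliable_one_add_of_summable
      simp only [norm_neg, norm_pow]
      exact (summable_nat_add_iff 1).2 (summable_geometric_of_lt_one (norm_nonneg _) hq)
    simp only [← sub_eq_add_neg] at h1
    exact h1.pow 24
  exact h.hasProd.tendsto_prod_nat

lemma geom_le_sum {x : ℝ} (h0 : 0 ≤ x) (h1 : x < 1) (N : ℕ) : ∑ i ∈ Finset.range N, x ^ (i + 1) ≤ x / (1 - x) := by
  have h := Summable.sum_le_tsum (Finset.range N) (fun i _ => pow_nonneg h0 i) (summable_geometric_of_lt_one h0 h1)
  rw [tsum_geometric_of_lt_one h0 h1] at h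
  simp only [pow_succ', ← Finset.mul_sum]
  rw [div_eq_mul_inv]
  gcongr

lemma dd_le {q : ℂ} {x : ℝ} (hq : ‖q‖ ≤ x) (h1 : x < 1) : ‖dd q‖ ≤ Real.exp (24 * (x / (1 - x))) := by
  have h0 : 0 ≤ x := (norm_nonneg _).trans hq
  refine le_of_tendsto (dd_tendsto (hq.trans_lt h1)).norm (Eventually.of_forall fun N => ?_)
  rw [norm_prod]
  have : ∀ i ∈ Finset.range N, ‖(1 - q ^ (i + 1)) ^ 24‖ ≤ Real.exp (24 * x ^ (i + 1)) := by
    intro i _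
    rw [norm_pow, show (24:ℝ) = ((24:ℕ):ℝ) by norm_num, Real.exp_nat_mul]
    gcongr
    calc ‖1 - q ^ (i + 1)‖ ≤ ‖(1:ℂ)‖ + ‖q ^ (i + 1)‖ := norm_sub_le _ _
      _ ≤ x ^ (i + 1) + 1 := by rw [norm_one, norm_pow, add_comm]; gcongr
      _ ≤ _ := Real.add_one_le_exp _
  refine (Finset.prod_le_prod (fun _ _ => norm_nonneg _) this).trans ?_
  rw [← Real.exp_sum, ← Finset.mul_sum, Real.exp_le_exp]
  gcongr
  exact geom_le_sum h0 h1 N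

lemma dd_ge {q : ℂ} {x : ℝ} (hq : ‖q‖ ≤ x) (h1 : x < 1) : Real.exp (-(24 * (x / (1 - x) ^ 2))) ≤ ‖dd q‖ := by
  have h0 : 0 ≤ x := (norm_nonneg _).trans hq
  refine ge_of_tendsto (dd_tendsto (hq.trans_lt h1)).norm (Eventually.of_forall fun N => ?_)
  rw [norm_prod]
  have hx : 0 < 1 - x := by linarith
  have : ∀ i ∈ Finset.range N, Real.exp (-(24 * (x ^ (i + 1) / (1 - x)))) ≤ ‖(1 - q ^ (i + 1)) ^ 24‖ := by
    intro i _
    rw [norm_pow, show (24:ℝ) = ((24:ℕ):ℝ) by norm_num, ← mul_neg, Real.exp_nat_mul]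
    gcongr
    have hi : x ^ (i + 1) ≤ x := by
      rw [pow_succ]; exact mul_le_of_le_one_left h0 (pow_le_one₀ h0 h1.le)
    have hy : 0 ≤ x ^ (i + 1) := by positivity
    calc Real.exp (-(x ^ (i + 1) / (1 - x))) ≤ 1 - x ^ (i + 1) := by
          rw [Real.exp_neg]
          apply inv_le_of_inv_le₀ (by linarith)
          refine le_trans ?_ (Real.add_one_le_exp _)
          rw [inv_le_iff_one_le_mul₀ (by linarith)]
          have : x ^ (i + 1) ≤ (x ^ (i+1) / (1 - x)) * (1 - x ^ (i + 1)) := by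
            rw [div_mul_eq_mul_div, le_div_iff₀ hx]
            gcongr
          nlinarith
      _ ≤ 1 - ‖q ^ (i + 1)‖ := by rw [norm_pow]; gcongr
      _ ≤ _ := by
        have := norm_sub_norm_le (1:ℂ) (q ^ (i + 1))
        rwa [norm_one] at this
  refine le_trans ?_ (Finset.prod_le_prod (fun _ _ => (Real.exp_pos _).le) this)
  rw [← Real.exp_sum, Finset.sum_neg_distrib, ← Finset.mul_sum, ← Finset.sum_div, Real.exp_le_exp]
  have := geom_le_sum h0 h1 N
  rw [neg_le_neg_iff, pow_two, ← div_div]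
  gcongr

lemma e_bd : (2.718:ℝ) ≤ Real.exp 1 := by have := Real.exp_one_gt_d9; linarith

lemma exp4 (t : ℝ) (ht : 0 ≤ t) : (54.5:ℝ) * (1 + t) ≤ Real.exp (4 + t) := by
  rw [Real.exp_add]
  have h1 : (54.5:ℝ) ≤ Real.exp 4 := by
    have : Real.exp 4 = Real.exp 1 ^ 4 := by rw [← Real.exp_nat_mul]; norm_num
    rw [this]
    calc (54.5:ℝ) ≤ 2.718 ^ 4 := by norm_num
      _ ≤ _ := by gcongr; exact e_bd
  have := Real.add_one_le_exp t
  gcongr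
  linarith

lemma r34 : Real.exp (-2 * π * (3 / 4)) ≤ 0.011 := by
  rw [show -2 * π * (3 / 4) = -(4 + (3 / 2 * π - 4)) by ring, Real.exp_neg]
  have := Real.pi_gt_d2
  have := exp4 (3 / 2 * π - 4) (by linarith)
  apply inv_le_of_inv_le₀ (by norm_num)
  norm_num at *; linarith

lemma r23 : Real.exp (-2 * π * (2 / 3)) ≤ 0.016 := by
  rw [show -2 * π * (2 / 3) = -(4 + (4 / 3 * π - 4)) by ring, Real.exp_neg]
  have := Real.pi_gt_d2
  have := exp4 (4 / 3 * π - 4) (by linarith)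
  apply inv_le_of_inv_le₀ (by norm_num)
  norm_num at *; linarith

lemma s_bd : Real.exp (-2 * π * (√3 / 2)) ≤ 0.008 := by
  have hs := sqrt3_gt
  have hp := Real.pi_gt_d2
  have h2 : 5.4 ≤ π * √3 := by nlinarith
  rw [show -2 * π * (√3 / 2) = -(4 + (π * √3 - 4)) by ring, Real.exp_neg]
  have := exp4 (π * √3 - 4) (by linarith)
  apply inv_le_of_inv_le₀ (by norm_num)
  norm_num at *; linarith

lemma num34 : 24 * ((0.008:ℝ) / (1 - 0.008)) + 24 * (0.011 / (1 - 0.011) ^ 2) < 14 / 9 * π * (√3 / 2 - 3 / 4) := by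
  have hs := sqrt3_gt
  have hp := Real.pi_gt_d2
  calc _ < 14 / 9 * 3.14 * (1.732 / 2 - 3 / 4 : ℝ) := by norm_num
    _ ≤ _ := by gcongr

lemma num23 : 24 * ((0.008:ℝ) / (1 - 0.008)) + 24 * (0.016 / (1 - 0.016) ^ 2) < 14 / 9 * π * (√3 / 2 - 2 / 3) := by
  have hs := sqrt3_gt
  have hp := Real.pi_gt_d2
  calc _ < 14 / 9 * 3.14 * (1.732 / 2 - 2 / 3 : ℝ) := by norm_num
    _ ≤ _ := by gcongr

end

section
set_option autoImplicit false

open scoped ComplexConjugate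

/-- normalizing factor, real on the arc -/
def RR (ℓ k' : ℕ) (θ : ℝ) : ℂ := zt θ ^ (6 * ℓ + k' / 2) * (Disc (zt θ) ^ ℓ * Eis k' (zt θ))

lemma kk_cases {k' : ℕ} (hk' : k' = 0 ∨ k' = 4 ∨ k' = 6 ∨ k' = 8 ∨ k' = 10 ∨ k' = 14) : (k' = 0 ∨ 3 ≤ k') ∧ 2 * (k' / 2) = k' := by
  omega

lemma Disc_conj {z : ℂ} (hz : 0 < z.im) : Disc (- conj z) = conj (Disc z) := by
  rw [Disc_eq_dd, Disc_eq_dd, qexp_conj, dd_conj (norm_qexp_lt_one hz) (qexp_ne_zero _), map_mul]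

lemma RR_real {ℓ k' : ℕ} (hk' : k' = 0 ∨ k' = 4 ∨ k' = 6 ∨ k' = 8 ∨ k' = 10 ∨ k' = 14) {θ : ℝ} (h : θ ∈ Set.Icc (π / 2) (2 * π / 3)) :
    conj (RR ℓ k' θ) = RR ℓ k' θ := by
  obtain ⟨h1, h2⟩ := kk_cases hk'
  have hz := zt_im_pos h
  have hz0 := zt_ne θ
  have hc : conj (zt θ) = (zt θ)⁻¹ := by
    have := zt_conj θ
    rw [neg_div, one_div] at this
    exact (neg_injective this).symm
  unfold RR
  rw [map_mul, map_mul, map_pow, map_pow, ← Disc_conj hz, ← Eis_conj, ← zt_conj, Disc_S hz, Eis_S h1 hz, hc]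
  have e : (zt θ)⁻¹ ^ (6 * ℓ + k' / 2) * ((zt θ ^ 12) ^ ℓ * zt θ ^ k') = zt θ ^ (6 * ℓ + k' / 2) := by
    rw [inv_pow, ← pow_mul, ← pow_add, inv_mul_eq_iff_eq_mul₀ (pow_ne_zero _ hz0), ← pow_add]
    congr 1; omega
  linear_combination (Disc (zt θ) ^ ℓ * Eis k' (zt θ)) * e

set_option maxHeartbeats 1000000 in
lemma err_bound (k' : ℕ) (hk' : k' = 0 ∨ k' = 4 ∨ k' = 6 ∨ k' = 8 ∨ k' = 10 ∨ k' = 14) (A r₀ : ℝ) (hA : 0 < A) (hr : Real.exp (-2 * π * A) ≤ r₀) (hr1 : r₀ < 1)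
    (hnum : 24 * ((0.008:ℝ) / (1 - 0.008)) + 24 * (r₀ / (1 - r₀) ^ 2) < 14 / 9 * π * (√3 / 2 - A)) (hA2 : A ≤ √3 / 2)
    (P : Set ℝ) (hP : IsCompact P) (hPs : P ⊆ Set.Icc (π / 2) (2 * π / 3))
    (hne : ∀ θ ∈ P, ∀ q : ℂ, ‖q‖ = Real.exp (-2 * π * A) → uu q - (gj θ : ℂ) * q ≠ 0) :
    ∃ C κ : ℝ, 0 ≤ κ ∧ κ < 1 ∧ ∀ ℓ m : ℕ, 9 * m ≤ 2 * ℓ → ∀ θ ∈ P,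
      ‖((Real.exp (2 * π * m * Real.sin θ) : ℝ) : ℂ) * RR ℓ k' θ * ((2 * π * I)⁻¹ * ∮ q in C(0, Real.exp (-2 * π * A)), VV ℓ k' m q / (uu q - (gj θ : ℂ) * q))‖ ≤ C * κ ^ ℓ := by
  obtain ⟨hk1, hk2⟩ := kk_cases hk'
  set r := Real.exp (-2 * π * A) with hrdef
  have hr0 : 0 < r := Real.exp_pos _
  have hrlt : r < 1 := hr.trans_lt hr1
  have hq1 : ∀ q : ℂ, ‖q‖ = r → ‖q‖ < 1 := fun q h => by rw [h]; exact hrlt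
  -- compactness bound
  have hcpt : IsCompact (P ×ˢ Metric.sphere (0:ℂ) r) := hP.prod (isCompact_sphere _ _)
  have hcont : ContinuousOn (fun x : ℝ × ℂ => ‖Eis k' (zt x.1)‖ * ‖ec (14 - k') x.2‖ / (‖dd x.2‖ * ‖uu x.2 - (gj x.1 : ℂ) * x.2‖)) (P ×ˢ Metric.sphere (0:ℂ) r) := by
    have hs2 : Set.MapsTo Prod.snd (P ×ˢ Metric.sphere (0:ℂ) r) (Metric.sphere (0:ℂ) r) := fun x hx => hx.2
    have hs1 : Set.MapsTo Prod.fst (P ×ˢ Metric.sphere (0:ℂ) r) P := fun x hx => hx.1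
    have c1 : ContinuousOn (fun θ : ℝ => Eis k' (zt θ)) P := by
      have : ContinuousOn (fun θ : ℝ => ec k' (qexp (zt θ))) P := by
        intro θ hθ
        have h1 := zt_im_pos (hPs hθ)
        have h2 : ContinuousAt (fun θ : ℝ => qexp (zt θ)) θ := by
          unfold qexp zt; fun_prop
        exact (ContinuousAt.comp (f := fun θ : ℝ => qexp (zt θ)) (ec_diff k' (norm_qexp_lt_one h1)).continuousAt h2).continuousWithinAt
      refine this.congr fun θ hθ => ?_
      exact (ec_qexp hk1 (zt_im_pos (hPs hθ))).symm
    have c2 : ContinuousOn (ec (14 - k')) (Metric.sphere (0:ℂ) r) := fun q hq =>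
      (ec_diff _ (hq1 q (by simpa using hq))).continuousAt.continuousWithinAt
    have c3 : ContinuousOn dd (Metric.sphere (0:ℂ) r) := fun q hq =>
      (dd_diff (hq1 q (by simpa using hq))).continuousAt.continuousWithinAt
    have c4 : ContinuousOn uu (Metric.sphere (0:ℂ) r) := fun q hq =>
      (uu_diff (hq1 q (by simpa using hq))).continuousAt.continuousWithinAt
    have c5 := gj_contOn.mono hPs
    have d1 := c1.comp continuousOn_fst hs1
    have d2 := c2.comp continuousOn_snd hs2
    have d3 := c3.comp continuousOn_snd hs2
    have d4 := c4.comp continuousOn_snd hs2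
    have d5 := Complex.continuous_ofReal.comp_continuousOn (c5.comp continuousOn_fst hs1)
    refine ContinuousOn.div (d1.norm.mul d2.norm) (d3.norm.mul (d4.sub (d5.mul continuousOn_snd)).norm) ?_
    intro x hx
    have hx2 : ‖x.2‖ = r := by simpa using hx.2
    exact mul_ne_zero (norm_ne_zero_iff.2 (dd_ne_zero (hq1 _ hx2))) (norm_ne_zero_iff.2 (hne _ hx.1 _ hx2))
  obtain ⟨B, hB⟩ := hcpt.bddAbove_image hcont
  set a : ℝ := 24 * ((0.008:ℝ) / (1 - 0.008)) + 24 * (r₀ / (1 - r₀) ^ 2) with ha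
  set b : ℝ := 2 * π * (√3 / 2 - A) with hb
  refine ⟨|B|, Real.exp (a - 7 / 9 * b), (Real.exp_pos _).le, ?_, ?_⟩
  · apply Real.exp_lt_one_iff.2; rw [hb]; linarith
  intro ℓ m hm θ hθ
  have hθ' := hPs hθ
  have hz := zt_im_pos hθ'
  have hmul : ((Real.exp (2 * π * m * Real.sin θ) : ℝ) : ℂ) * RR ℓ k' θ * ((2 * π * I)⁻¹ * ∮ q in C(0, r), VV ℓ k' m q / (uu q - (gj θ : ℂ) * q))
    = (2 * π * I)⁻¹ • ∮ q in C(0, r), ((Real.exp (2 * π * m * Real.sin θ) : ℝ) : ℂ) * RR ℓ k' θ * (VV ℓ k' m q / (uu q - (gj θ : ℂ) * q)) := by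
    rw [circleIntegral.integral_const_mul, smul_eq_mul]; ring
  rw [hmul]
  have hfin : |B| * Real.exp (a - 7 / 9 * b) ^ ℓ = r * (|B| * Real.exp (a - 7 / 9 * b) ^ ℓ / r) := by field_simp
  rw [hfin]
  refine circleIntegral.norm_two_pi_i_inv_smul_integral_le_of_norm_le_const hr0.le fun q hq => ?_
  have hqr : ‖q‖ = r := by simpa using hq
  have hH := hB (Set.mem_image_of_mem _ (Set.mk_mem_prod hθ hq))
  simp only at hH
  set s := ‖qexp (zt θ)‖ with hs
  have hs' : s = Real.exp (-2 * π * Real.sin θ) := by rw [hs, norm_qexp, zt_im]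
  have hs0 : 0 < s := by rw [hs']; exact Real.exp_pos _
  have hes : Real.exp (2 * π * m * Real.sin θ) = (s ^ m)⁻¹ := by
    rw [hs', ← Real.exp_nat_mul, ← Real.exp_neg]; congr 1; ring
  have hdq := dd_ge (hqr.le.trans hr) hr1
  have hsle : s ≤ Real.exp (-2 * π * (√3 / 2)) := by
    rw [hs', Real.exp_le_exp]
    have := arc_sin_ge hθ'
    nlinarith [Real.pi_pos]
  have hdz := dd_le (q := qexp (zt θ)) (hsle.trans s_bd) (by norm_num)
  have hdq0 : 0 < ‖dd q‖ := (Real.exp_pos _).trans_le hdq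
  have hratio : ‖dd (qexp (zt θ))‖ / ‖dd q‖ ≤ Real.exp a := by
    rw [div_le_iff₀ hdq0]
    refine hdz.trans ?_
    rw [ha, Real.exp_add, mul_assoc]
    refine le_mul_of_one_le_right (Real.exp_pos _).le ?_
    calc (1:ℝ) = Real.exp (24 * (r₀ / (1 - r₀) ^ 2)) * Real.exp (-(24 * (r₀ / (1 - r₀) ^ 2))) := by rw [← Real.exp_add]; simp
      _ ≤ _ := by gcongr
  have hsr : (s / r) ^ (ℓ - m) ≤ Real.exp (-(7 / 9) * b) ^ ℓ := by
    have h1 : s / r ≤ Real.exp (- b) := by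
      rw [div_le_iff₀ hr0, hrdef, ← Real.exp_add]
      refine hsle.trans (le_of_eq ?_)
      congr 1; rw [hb]; ring
    refine (pow_le_pow_left₀ (by positivity) h1 _).trans ?_
    rw [← Real.exp_nat_mul, ← Real.exp_nat_mul, Real.exp_le_exp]
    have h2 : (7:ℝ) / 9 * ℓ ≤ ((ℓ - m : ℕ) : ℝ) := by
      rw [Nat.cast_sub (by omega)]
      have : (9:ℝ) * m ≤ 2 * ℓ := by exact_mod_cast hm
      linarith
    have h3 : 0 ≤ b := by rw [hb]; have := Real.pi_pos; have := sub_nonneg.2 hA2; positivity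
    nlinarith
  have hD : 0 < ‖uu q - (gj θ : ℂ) * q‖ := norm_pos_iff.2 (hne θ hθ q hqr)
  rw [norm_mul, norm_mul, norm_div, Complex.norm_real, Real.norm_eq_abs, abs_of_pos (Real.exp_pos _), hes]
  unfold RR VV
  simp only [norm_mul, norm_pow, norm_div, zt_norm, one_pow, one_mul, Disc_eq_dd, hqr, ← hs]
  have hexp : ℓ = (ℓ - m) + m := by omega
  have hdz0 : 0 ≤ ‖dd (qexp (zt θ))‖ := norm_nonneg _
  clear hmul hfin hdz hdq hsle hes hs' hcont hB hne hcpt hnum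
  clear_value a b s r
  generalize ‖dd (qexp (zt θ))‖ = Y at *
  calc _ = (‖Eis k' (zt θ)‖ * ‖ec (14 - k') q‖ / (‖dd q‖ * ‖uu q - (gj θ : ℂ) * q‖)) * ((s / r) ^ (ℓ - m)) * (Y / ‖dd q‖) ^ ℓ / r := by
        have e1 : s ^ ℓ = s ^ (ℓ - m) * s ^ m := by rw [← pow_add]; congr 1
        have e2 : r ^ ℓ = r ^ (ℓ - m) * r ^ m := by rw [← pow_add]; congr 1
        rw [mul_pow, mul_pow, e1, pow_succ, e2, pow_succ, div_pow, div_pow]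
        field_simp
    _ ≤ |B| * Real.exp (-(7 / 9) * b) ^ ℓ * Real.exp a ^ ℓ / r := by
        refine div_le_div_of_nonneg_right ?_ hr0.le
        refine mul_le_mul (mul_le_mul (hH.trans (le_abs_self B)) hsr (by positivity) (abs_nonneg B))
          (pow_le_pow_left₀ (by positivity) hratio ℓ) (by positivity) (by positivity)
    _ = _ := by
        rw [mul_assoc, ← mul_pow, ← Real.exp_add]
        congr 4; ring

end

section
set_option autoImplicit false

open scoped ComplexConjugate

/-- the phase -/
def ph (ℓ k' m : ℕ) (θ : ℝ) : ℝ := ((6 * ℓ + k' / 2 : ℕ) : ℝ) * θ + 2 * π * m * Real.cos θ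

lemma TT_qexp {ℓ k' m : ℕ} (hk1 : k' = 0 ∨ 3 ≤ k') {τ : ℂ} (hτ : 0 < τ.im) :
    TT ℓ k' m (qexp τ) = qexp τ ^ m / (Disc τ ^ ℓ * Eis k' τ) := by
  rw [TT, Disc_eq_dd, ec_qexp hk1 hτ]

lemma ec_ne_arc {k' : ℕ} (hk' : k' = 0 ∨ k' = 4 ∨ k' = 6 ∨ k' = 8 ∨ k' = 10 ∨ k' = 14) {θ : ℝ} (h : θ ∈ Set.Ioo (π / 2) (2 * π / 3)) :
    Eis k' (zt θ) ≠ 0 := by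
  have hz := zt_im_pos (Set.Ioo_subset_Icc_self h)
  have h1 := (root_cond h hz rfl).2
  rw [← ec_mul hk' (norm_qexp_lt_one hz)] at h1
  rw [← ec_qexp (kk_cases hk').1 hz]
  exact left_ne_zero_of_mul h1

lemma term1 {ℓ k' m : ℕ} (hk' : k' = 0 ∨ k' = 4 ∨ k' = 6 ∨ k' = 8 ∨ k' = 10 ∨ k' = 14) {θ : ℝ} (h : θ ∈ Set.Ioo (π / 2) (2 * π / 3)) :
    ((Real.exp (2 * π * m * Real.sin θ) : ℝ) : ℂ) * RR ℓ k' θ * TT ℓ k' m (qexp (zt θ)) = Complex.exp (ph ℓ k' m θ * I) := by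
  have hz := zt_im_pos (Set.Ioo_subset_Icc_self h)
  rw [TT_qexp (kk_cases hk').1 hz, RR]
  have h1 := pow_ne_zero ℓ (Disc_ne_zero hz)
  have h2 := ec_ne_arc hk' h
  have e : ((Real.exp (2 * π * m * Real.sin θ) : ℝ) : ℂ) * (zt θ ^ (6 * ℓ + k' / 2) * (Disc (zt θ) ^ ℓ * Eis k' (zt θ))) * (qexp (zt θ) ^ m / (Disc (zt θ) ^ ℓ * Eis k' (zt θ))) = ((Real.exp (2 * π * m * Real.sin θ) : ℝ) : ℂ) * zt θ ^ (6 * ℓ + k' / 2) * qexp (zt θ) ^ m := by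
    field_simp
  have hzz : zt θ = Real.cos θ + Real.sin θ * I := by
    apply Complex.ext <;> simp [zt_re, zt_im, -ofReal_cos, -ofReal_sin]
  rw [e]
  have e2 : qexp (zt θ) ^ m = Complex.exp (m * (2 * π * I * (Real.cos θ + Real.sin θ * I))) := by
    rw [qexp, ← Complex.exp_nat_mul, hzz]
  rw [e2, zt, ← Complex.exp_nat_mul, Complex.ofReal_exp, ← Complex.exp_add, ← Complex.exp_add]
  congr 1
  rw [ph]
  push_cast
  linear_combination (2 * π * m * Complex.sin θ) * Complex.I_sq

lemma term2 {ℓ k' m : ℕ} (hk' : k' = 0 ∨ k' = 4 ∨ k' = 6 ∨ k' = 8 ∨ k' = 10 ∨ k' = 14) {θ : ℝ} (h : θ ∈ Set.Ioo (π / 2) (2 * π / 3)) :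
    ((Real.exp (2 * π * m * Real.sin θ) : ℝ) : ℂ) * RR ℓ k' θ * TT ℓ k' m (qexp (-1 / zt θ)) = conj (Complex.exp (ph ℓ k' m θ * I)) := by
  have h' := Set.Ioo_subset_Icc_self h
  have hz := zt_im_pos h'
  rw [← term1 hk' h, map_mul, map_mul, RR_real hk' h', Complex.conj_ofReal, TT_qexp (kk_cases hk').1 hz, TT_qexp (kk_cases hk').1 (S_im_pos hz),
    zt_conj, qexp_conj, Disc_conj hz, Eis_conj]
  simp only [map_mul, map_div₀, map_pow]

lemma term12 {ℓ k' m : ℕ} (hk' : k' = 0 ∨ k' = 4 ∨ k' = 6 ∨ k' = 8 ∨ k' = 10 ∨ k' = 14) {θ : ℝ} (h : θ ∈ Set.Ioo (π / 2) (2 * π / 3)) :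
    (((Real.exp (2 * π * m * Real.sin θ) : ℝ) : ℂ) * RR ℓ k' θ * (TT ℓ k' m (qexp (zt θ)) + TT ℓ k' m (qexp (-1 / zt θ)))).re = 2 * Real.cos (ph ℓ k' m θ) := by
  rw [mul_add, term1 hk' h, term2 hk' h, Complex.add_re, Complex.conj_re, Complex.exp_ofReal_mul_I_re]; ring

lemma term3 {ℓ k' m : ℕ} (hk' : k' = 0 ∨ k' = 4 ∨ k' = 6 ∨ k' = 8 ∨ k' = 10 ∨ k' = 14) (hm : 9 * m ≤ 2 * ℓ) {θ : ℝ} (h : θ ∈ Set.Ioo (π / 2) (2 * π / 3)) :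
    ‖((Real.exp (2 * π * m * Real.sin θ) : ℝ) : ℂ) * RR ℓ k' θ * TT ℓ k' m (qexp (-1 / (zt θ + 1)))‖ ≤ 1 := by
  have h' := Set.Ioo_subset_Icc_self h
  have hz := zt_im_pos h'
  have hz1 : 0 < (zt θ + 1).im := by simpa using hz
  have hk1 := (kk_cases hk').1
  have h1 := Disc_ne_zero hz
  have h2 := ec_ne_arc hk' h
  have h3 := arc_add_ne h'
  rw [TT_qexp hk1 (S_im_pos hz1), Disc_S hz1, Eis_S hk1 hz1, Disc_T, Eis_T hk1 hz, RR]
  have e : ((Real.exp (2 * π * m * Real.sin θ) : ℝ) : ℂ) * (zt θ ^ (6 * ℓ + k' / 2) * (Disc (zt θ) ^ ℓ * Eis k' (zt θ))) * (qexp (-1 / (zt θ + 1)) ^ m / (((zt θ + 1) ^ 12 * Disc (zt θ)) ^ ℓ * ((zt θ + 1) ^ k' * Eis k' (zt θ)))) = ((Real.exp (2 * π * m * Real.sin θ) : ℝ) : ℂ) * zt θ ^ (6 * ℓ + k' / 2) * qexp (-1 / (zt θ + 1)) ^ m / ((zt θ + 1) ^ 2) ^ (6 * ℓ + k' / 2)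 := by
    have : ((zt θ + 1) ^ 2) ^ (6 * ℓ + k' / 2) = ((zt θ + 1) ^ 12) ^ ℓ * (zt θ + 1) ^ k' := by
      rw [← pow_mul, ← pow_mul, ← pow_add]; congr 1; have := kk_cases hk'; omega
    rw [this, mul_pow]
    field_simp
  rw [e]
  set t := 2 + 2 * Real.cos θ with ht
  have ht1 : 1 < t := by have := (arc_cos_lt h).1; linarith
  have hn : ‖(zt θ + 1) ^ 2‖ = t := by
    rw [norm_pow, ← Complex.normSq_eq_norm_sq]
    have := normSq_form θ 1 1
    push_cast at this
    rw [one_mul] at this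
    rw [this]; ring
  rw [norm_div, norm_mul, norm_mul, norm_pow, norm_pow, norm_pow _ (6 * ℓ + k' / 2), hn, zt_norm, one_pow, mul_one, norm_qexp, z3_im, ← ht,
    Complex.norm_real, Real.norm_eq_abs, abs_of_pos (Real.exp_pos _), ← Real.exp_nat_mul, ← Real.exp_add]
  apply div_le_one_of_le₀ _ (by positivity)
  have hlog : Real.exp (1 - t⁻¹) ≤ t := by
    rw [← Real.le_log_iff_exp_le (by linarith)]
    exact Real.one_sub_inv_le_log_of_pos (by linarith)
  refine le_trans ?_ (pow_le_pow_left₀ (Real.exp_pos _).le hlog _)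
  rw [← Real.exp_nat_mul, Real.exp_le_exp]
  have hs := Real.sin_le_one θ
  have hs0 := arc_sin_pos h'
  have ht0 : 0 ≤ 1 - t⁻¹ := by
    have := inv_le_one_of_one_le₀ ht1.le; linarith
  have e3 : 2 * π * m * Real.sin θ + m * (-2 * π * (Real.sin θ / t)) = (2 * π * m * Real.sin θ) * (1 - t⁻¹) := by ring
  rw [e3]
  refine mul_le_mul_of_nonneg_right ?_ ht0
  have hpi := Real.pi_lt_four
  have hm' : (9:ℝ) * m ≤ 2 * ℓ := by exact_mod_cast hm
  have hkk : (6:ℝ) * ℓ ≤ ((6 * ℓ + k' / 2 : ℕ) : ℝ) := by exact_mod_cast Nat.le_add_right _ _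
  have hm0 : (0:ℝ) ≤ m := Nat.cast_nonneg m
  calc 2 * π * m * Real.sin θ ≤ 2 * 4 * m * 1 := by gcongr
    _ ≤ _ := by linarith

lemma main_est (k' : ℕ) (hk' : k' = 0 ∨ k' = 4 ∨ k' = 6 ∨ k' = 8 ∨ k' = 10 ∨ k' = 14) :
    ∃ L : ℕ, ∀ ℓ m : ℕ, L ≤ ℓ → 9 * m ≤ 2 * ℓ → ∀ (f : ℂ → ℂ) (F : Polynomial ℂ), IsMillerForm ℓ k' m f → IsFaber ℓ k' m f F →
      ∀ θ ∈ Set.Ioo (π / 2) (2 * π / 3),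
        |(((Real.exp (2 * π * m * Real.sin θ) : ℝ) : ℂ) * RR ℓ k' θ * F.eval (gj θ : ℂ)).re - 2 * Real.cos (ph ℓ k' m θ)| ≤ 3 / 2 := by
  have hs3 := sqrt3_gt
  have hcl1 : IsClosed {θ : ℝ | -1 / 3 ≤ Real.cos θ} := isClosed_le continuous_const Real.continuous_cos
  have hcl2 : IsClosed {θ : ℝ | Real.cos θ ≤ -1 / 3} := isClosed_le Real.continuous_cos continuous_const
  have hnn : ∀ θ ∈ Set.Icc (π / 2) (2 * π / 3), ∀ A < √3 / 2, ∀ q, ‖q‖ = Real.exp (-2 * π * A) →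
      q = qexp (zt θ) ∨ q = qexp (-1 / zt θ) → False := by
    intro θ hθ A hA q hq hqq
    have h1 : ‖q‖ = Real.exp (-2 * π * Real.sin θ) := by
      rcases hqq with rfl | rfl
      · rw [norm_qexp, zt_im]
      · rw [norm_qexp, zt_conj]; simp [zt_im]
    rw [h1, Real.exp_eq_exp] at hq
    have h2 := arc_sin_ge hθ
    nlinarith [Real.pi_pos]
  obtain ⟨C1, κ1, hκ0, hκ1, H1⟩ := err_bound k' hk' (3 / 4) 0.011 (by norm_num) r34 (by norm_num) num34 (by linarith)
    (Set.Icc (π / 2) (2 * π / 3) ∩ {θ : ℝ | -1 / 3 ≤ Real.cos θ}) (isCompact_Icc.inter_right hcl1) Set.inter_subset_left (by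
      rintro θ ⟨hθ, hc⟩ q hq h0
      obtain ⟨τ, h1, h2, rfl⟩ := root_conv hθ (by norm_num) hq.le (sub_eq_zero.1 h0)
      exact hnn θ hθ (3 / 4) (by linarith) _ hq (enum2 hθ hc h1 h2))
  obtain ⟨C2, κ2, hκ20, hκ2, H2⟩ := err_bound k' hk' (2 / 3) 0.016 (by norm_num) r23 (by norm_num) num23 (by linarith)
    (Set.Icc (π / 2) (2 * π / 3) ∩ {θ : ℝ | Real.cos θ ≤ -1 / 3}) (isCompact_Icc.inter_right hcl2) Set.inter_subset_left (by
      rintro θ ⟨hθ, hc⟩ q hq h0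
      obtain ⟨τ, h1, h2, rfl⟩ := root_conv hθ (by norm_num) hq.le (sub_eq_zero.1 h0)
      rcases enum3 hθ h1 h2 with h3 | h3 | ⟨h3, -⟩
      · exact hnn θ hθ (2 / 3) (by linarith) _ hq (Or.inl h3)
      · exact hnn θ hθ (2 / 3) (by linarith) _ hq (Or.inr h3)
      · rw [h3, norm_qexp, Real.exp_eq_exp] at hq
        have h4 := z3_im_ge hθ hc
        nlinarith [Real.pi_pos])
  have t1 := (tendsto_pow_atTop_nhds_zero_of_lt_one hκ0 hκ1).const_mul C1
  have t2 := (tendsto_pow_atTop_nhds_zero_of_lt_one hκ20 hκ2).const_mul C2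
  rw [mul_zero] at t1 t2
  obtain ⟨L, hL⟩ := eventually_atTop.1 ((t1.eventually_le_const (show (0:ℝ) < 1 / 2 by norm_num)).and (t2.eventually_le_const (show (0:ℝ) < 1 / 2 by norm_num)))
  refine ⟨L, fun ℓ m hℓ hm f F hf hF θ hθ => ?_⟩
  obtain ⟨hL1, hL2⟩ := hL ℓ hℓ
  have hθ' := Set.Ioo_subset_Icc_self hθ
  rcases le_total (-1 / 3) (Real.cos θ) with hc | hc
  · rw [formula2 hk' (by omega) hf hF hθ hc, mul_add, Complex.add_re, term12 hk' hθ, add_sub_cancel_left]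
    have := H1 ℓ m hm θ ⟨hθ', hc⟩
    refine (Complex.abs_re_le_norm _).trans ?_
    linarith
  · rw [formula3 hk' (by omega) hf hF hθ hc, mul_add, mul_add, Complex.add_re, Complex.add_re, term12 hk' hθ, add_assoc, add_sub_cancel_left]
    have h1 := H2 ℓ m hm θ ⟨hθ', hc⟩
    have h2 := term3 hk' hm hθ
    refine (abs_add_le _ _).trans ?_
    have h3 := (Complex.abs_re_le_norm _).trans h1
    have h4 := (Complex.abs_re_le_norm _).trans h2
    linarith

end

section
set_option autoImplicit false

open scoped ComplexConjugate

/-- the polynomial of imaginary parts of the coefficients -/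
def imPoly (F : ℂ[X]) : ℝ[X] := ∑ i ∈ Finset.range (F.natDegree + 1), Polynomial.C (F.coeff i).im * X ^ i

lemma imPoly_eval (F : ℂ[X]) (x : ℝ) : (F.eval (x : ℂ)).im = (imPoly F).eval x := by
  rw [Polynomial.eval_eq_sum_range, imPoly, Polynomial.eval_finsetSum, Complex.im_sum]
  refine Finset.sum_congr rfl fun i _ => ?_
  rw [← Complex.ofReal_pow, Complex.im_mul_ofReal]
  simp

lemma poly_zero_of_tendsto (G : ℝ[X]) {α : Type*} {l : Filter α} [l.NeBot] {u : α → ℝ} (hu : Tendsto u l atTop)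
    (h : Tendsto (fun x => G.eval (u x)) l (𝓝 0)) : G = 0 := by
  by_cases hd : 0 < G.degree
  · have h1 := (G.abs_tendsto_atTop hd).comp hu
    have h2 := h.abs
    exact absurd h2 (not_tendsto_nhds_of_tendsto_atTop h1 _)
  · rw [not_lt] at hd
    rw [Polynomial.eq_C_of_degree_le_zero hd] at h ⊢
    simp only [eval_C] at h
    rw [tendsto_nhds_unique tendsto_const_nhds h, map_zero]

lemma F_real {ℓ k' m : ℕ} (hk' : k' = 0 ∨ k' = 4 ∨ k' = 6 ∨ k' = 8 ∨ k' = 10 ∨ k' = 14)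
    (hm : m ≤ ℓ) {f : ℂ → ℂ} {F : ℂ[X]} (hf : IsMillerForm ℓ k' m f) (hF : IsFaber ℓ k' m f F) (x : ℝ) :
    (F.eval (x : ℂ)).im = 0 := by
  obtain ⟨hk1, hk2⟩ := kk_cases hk'
  rw [imPoly_eval]
  obtain ⟨-, -, -, a, ha1, ha2⟩ := hf
  obtain ⟨-, -, hF⟩ := hF
  set T : ℂ → ℂ := fun q => ∑' n, a (n + (ℓ + 1)) * q ^ n with hT
  have hTd := tail_diff a (fun z hz => (ha1 z hz).1) (ℓ + 1)
  have hid : ∀ q : ℂ, q ≠ 0 → ‖q‖ < 1 → dd q ^ ℓ * ec k' q * F.eval (uu q / q) = q ^ m / q ^ ℓ + q * T q := by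
    intro q h0 hq
    obtain ⟨z, hz, rfl⟩ := qexp_surj h0 hq
    have hfz := (ha1 z hz).2
    rw [hF z hz, jinv_eq_uu hz, Disc_eq_dd, ← ec_qexp (by omega) hz] at hfz
    have hsplit := (ha1 z hz).1.sum_add_tsum_nat_add (ℓ + 1)
    rw [← hfz] at hsplit
    have h1 : ∑ i ∈ Finset.range (ℓ + 1), a i * qexp z ^ i = qexp z ^ m := by
      rw [Finset.sum_eq_single m]
      · rw [ha2 m hm, if_pos rfl, one_mul]
      · intro b hb hbm
        rw [ha2 b (by simpa [Nat.lt_succ_iff] using hb), if_neg hbm, zero_mul]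
      · intro h; exact absurd (Finset.mem_range.2 (by omega)) h
    have h2 : ∑' i, a (i + (ℓ + 1)) * qexp z ^ (i + (ℓ + 1)) = qexp z ^ (ℓ + 1) * T (qexp z) := by
      rw [hT, ← tsum_mul_left]
      refine tsum_congr fun n => ?_
      rw [pow_add]; ring
    rw [h1, h2, mul_pow] at hsplit
    have := pow_ne_zero ℓ h0
    rw [div_add' _ _ _ this, eq_div_iff this]
    linear_combination -hsplit
  have hre : ∀ x : ℝ, 0 < x → x < 1 → ((dd x ^ ℓ * ec k' x).re * (imPoly F).eval ((uu x).re / x)) = ((x:ℂ) * T x).im := by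
    intro x h0 h1
    have hx0 : (x:ℂ) ≠ 0 := by exact_mod_cast h0.ne'
    have hx1 : ‖(x:ℂ)‖ < 1 := by rw [Complex.norm_real, Real.norm_eq_abs, abs_of_pos h0]; exact h1
    have c1 := dd_conj hx1 hx0
    have c2 := ec_conj hk1 hx1 hx0
    have c3 := uu_conj hx1 hx0
    rw [Complex.conj_ofReal] at c1 c2 c3
    have r3 : ((uu x).re : ℂ) = uu x := Complex.conj_eq_iff_re.1 c3.symm
    have r12 : ((dd x ^ ℓ * ec k' x).re : ℂ) = dd x ^ ℓ * ec k' x := by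
      apply Complex.conj_eq_iff_re.1
      rw [map_mul, map_pow, ← c1, ← c2]
    have h := hid x hx0 hx1
    rw [← r12, ← r3, ← Complex.ofReal_div] at h
    have h2 := congrArg Complex.im h
    rw [Complex.im_ofReal_mul, imPoly_eval, Complex.add_im, ← Complex.ofReal_pow, ← Complex.ofReal_pow, ← Complex.ofReal_div, Complex.ofReal_im, zero_add] at h2
    exact h2
  have hof : Tendsto (fun x : ℝ => (x:ℂ)) (𝓝[>] 0) (𝓝 0) := by
    have : Tendsto (fun x : ℝ => (x:ℂ)) (𝓝 0) (𝓝 ((0:ℝ):ℂ)) := Complex.continuous_ofReal.continuousAt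
    exact (by simpa using this : Tendsto (fun x : ℝ => (x:ℂ)) (𝓝 0) (𝓝 0)).mono_left nhdsWithin_le_nhds
  have h01 : ‖(0:ℂ)‖ < 1 := by simp
  have t1 : Tendsto (fun x : ℝ => (dd x ^ ℓ * ec k' x).re) (𝓝[>] 0) (𝓝 1) := by
    have : Tendsto (fun q : ℂ => (dd q ^ ℓ * ec k' q).re) (𝓝 0) (𝓝 ((dd 0 ^ ℓ * ec k' 0).re)) :=
      Complex.continuous_re.continuousAt.comp (((dd_diff h01).continuousAt.pow ℓ).mul (ec_diff k' h01).continuousAt)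
    rw [dd_zero, ec_zero ⟨k' / 2, by omega⟩, one_pow, one_mul, Complex.one_re] at this
    exact this.comp hof
  have t2 : Tendsto (fun x : ℝ => ((x:ℂ) * T x).im) (𝓝[>] 0) (𝓝 0) := by
    have hTc : ContinuousAt T 0 := (hTd.differentiableAt (Metric.ball_mem_nhds _ one_pos)).continuousAt
    have : Tendsto (fun q : ℂ => (q * T q).im) (𝓝 0) (𝓝 ((0 * T 0).im)) :=
      Complex.continuous_im.continuousAt.comp (continuousAt_id.mul hTc)
    rw [zero_mul, Complex.zero_im] at this
    exact this.comp hof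
  have t3 : Tendsto (fun x : ℝ => (uu x).re / x) (𝓝[>] 0) atTop := by
    have : Tendsto (fun q : ℂ => (uu q).re) (𝓝 0) (𝓝 ((uu 0).re)) :=
      Complex.continuous_re.continuousAt.comp (uu_diff h01).continuousAt
    rw [uu_zero, Complex.one_re] at this
    simp only [div_eq_mul_inv]
    exact (this.comp hof).pos_mul_atTop one_pos tendsto_inv_nhdsGT_zero
  have : imPoly F = 0 := by
    refine poly_zero_of_tendsto _ t3 ?_
    have t4 := t2.div t1 one_ne_zero
    rw [zero_div] at t4
    refine t4.congr' ?_
    have e1 : ∀ᶠ x : ℝ in 𝓝[>] 0, x ∈ Set.Ioo (0:ℝ) 1 := Ioo_mem_nhdsGT one_pos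
    have e2 : ∀ᶠ x : ℝ in 𝓝[>] 0, (dd x ^ ℓ * ec k' x).re ≠ 0 := t1.eventually_ne one_ne_zero
    filter_upwards [e1, e2] with x hx hx2
    rw [Pi.div_apply, ← hre x hx.1 hx.2, mul_div_cancel_left₀ _ hx2]
  rw [this]; simp

end

section
set_option autoImplicit false

open scoped ComplexConjugate

lemma ph_mono {ℓ k' m : ℕ} (hℓ : 0 < ℓ) (hm : 9 * m ≤ 2 * ℓ) : StrictMono (ph ℓ k' m) := by
  intro a b hab
  have h1 := Real.abs_cos_sub_cos_le a b
  rw [abs_sub_comm a b, abs_of_pos (sub_pos.2 hab)] at h1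
  have h2 := (abs_le.1 h1).2
  have hpi := Real.pi_lt_four
  have hp0 := Real.pi_pos
  have hm' : (9:ℝ) * m ≤ 2 * ℓ := by exact_mod_cast hm
  have hℓ' : (0:ℝ) < ℓ := by exact_mod_cast hℓ
  have hkk : (6:ℝ) * ℓ ≤ ((6 * ℓ + k' / 2 : ℕ) : ℝ) := by exact_mod_cast Nat.le_add_right _ _
  have hm0 : (0:ℝ) ≤ m := Nat.cast_nonneg m
  have h3 : 2 * π * m * (Real.cos a - Real.cos b) ≤ 2 * 4 * m * (b - a) := by
    have hba : 0 ≤ b - a := by linarith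
    calc _ ≤ 2 * π * m * (b - a) := by gcongr
      _ ≤ _ := by gcongr
  have h4 : 2 * 4 * m * (b - a) < ((6 * ℓ + k' / 2 : ℕ) : ℝ) * (b - a) := by
    have : 0 < b - a := by linarith
    gcongr
    linarith
  unfold ph
  nlinarith

lemma ph_cont (ℓ k' m : ℕ) : Continuous (ph ℓ k' m) := by unfold ph; fun_prop

lemma ph_left (ℓ k' m : ℕ) : ph ℓ k' m (π / 2) = (3 * ℓ + (k' / 2 : ℕ) / 2) * π := by
  unfold ph; rw [Real.cos_pi_div_two]; push_cast; ring

lemma ph_right (ℓ k' m : ℕ) : ph ℓ k' m (2 * π / 3) = (4 * ℓ - m + (k' / 2 : ℕ) * 2 / 3) * π := by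
  unfold ph; rw [cos_two_pi_div_three]; push_cast; ring

lemma near_interior {lo hi w : ℝ} (h : lo + 1 < hi) (h1 : lo ≤ w) (h2 : w ≤ hi) : ∃ v, lo < v ∧ v < hi ∧ |v - w| ≤ 0.1 := by
  rcases le_total w (lo + 0.5) with h3 | h3
  · refine ⟨w + 0.1, by linarith, by norm_num at *; linarith, ?_⟩
    rw [add_sub_cancel_left, abs_of_nonneg (by norm_num)]
  · refine ⟨w - 0.1, by norm_num at *; linarith, by norm_num at *; linarith, ?_⟩
    rw [sub_sub_cancel_left, abs_neg, abs_of_nonneg (by norm_num)]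

lemma RR_cont {ℓ k' : ℕ} (hk1 : k' = 0 ∨ 3 ≤ k') : ContinuousOn (RR ℓ k') (Set.Ioo (π / 2) (2 * π / 3)) := by
  have : ContinuousOn (fun θ => zt θ ^ (6 * ℓ + k' / 2) * ((qexp (zt θ) * dd (qexp (zt θ))) ^ ℓ * ec k' (qexp (zt θ)))) (Set.Ioo (π / 2) (2 * π / 3)) := by
    intro θ hθ
    have h1 := norm_qexp_lt_one (zt_im_pos (Set.Ioo_subset_Icc_self hθ))
    have h0 : ContinuousAt zt θ := by unfold zt; fun_prop
    have h2 : ContinuousAt (fun θ : ℝ => qexp (zt θ)) θ := by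
      unfold qexp zt; fun_prop
    have h3 := ContinuousAt.comp (f := fun θ : ℝ => qexp (zt θ)) (ec_diff k' h1).continuousAt h2
    have h4 := ContinuousAt.comp (f := fun θ : ℝ => qexp (zt θ)) (dd_diff h1).continuousAt h2
    exact ((h0.pow _).mul (((h2.mul h4).pow _).mul h3)).continuousWithinAt
  refine this.congr fun θ hθ => ?_
  simp only [RR, Disc_eq_dd, ec_qexp hk1 (zt_im_pos (Set.Ioo_subset_Icc_self hθ))]

lemma RR_ne {ℓ k' : ℕ} (hk' : k' = 0 ∨ k' = 4 ∨ k' = 6 ∨ k' = 8 ∨ k' = 10 ∨ k' = 14) {θ : ℝ} (h : θ ∈ Set.Ioo (π / 2) (2 * π / 3)) : RR ℓ k' θ ≠ 0 :=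
  mul_ne_zero (pow_ne_zero _ (zt_ne _)) (mul_ne_zero (pow_ne_zero _ (Disc_ne_zero (zt_im_pos (Set.Ioo_subset_Icc_self h)))) (ec_ne_arc hk' h))

lemma roots_lemma (k' : ℕ) (hk' : k' = 0 ∨ k' = 4 ∨ k' = 6 ∨ k' = 8 ∨ k' = 10 ∨ k' = 14) :
    ∃ L : ℕ, ∀ ℓ m : ℕ, L ≤ ℓ → 9 * m ≤ 2 * ℓ → ∀ (f : ℂ → ℂ) (F : Polynomial ℂ), IsMillerForm ℓ k' m f → IsFaber ℓ k' m f F →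
      ∃ x : ℕ → ℝ, (∀ i < ℓ - m, x i ∈ Set.Ioo (π / 2) (2 * π / 3)) ∧
        F.roots = (Multiset.range (ℓ - m)).map (fun i => (gj (x i) : ℂ)) ∧
        ∀ i < ℓ - m, ((3 * ℓ + (k' / 2 + 1) / 2 : ℕ) + i) * π - 0.1 ≤ ph ℓ k' m (x i) ∧
          ph ℓ k' m (x i) ≤ ((3 * ℓ + (k' / 2 + 1) / 2 : ℕ) + i + 1) * π + 0.1 := by
  obtain ⟨L, hL⟩ := main_est k' hk'
  refine ⟨max L 2, fun ℓ m hℓ hm f F hf hF => ?_⟩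
  have hℓL : L ≤ ℓ := (le_max_left _ _).trans hℓ
  have hℓ2 : 2 ≤ ℓ := (le_max_right _ _).trans hℓ
  have hmono := ph_mono (k' := k') (show 0 < ℓ by omega) hm
  have hest := hL ℓ m hℓL hm f F hf hF
  have hreal := F_real hk' (show m ≤ ℓ by omega) hf hF
  set h0 : ℕ := 3 * ℓ + (k' / 2 + 1) / 2 with hh0
  set φ := ph ℓ k' m with hφ
  set n := ℓ - m with hn
  have hnm : (n:ℝ) = ℓ - m := by rw [hn, Nat.cast_sub (by omega)]
  have hpi := Real.pi_gt_three
  have hp4 := Real.pi_lt_four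
  -- sample points
  have hsamp : ∀ i : ℕ, ∃ θ : ℝ, i ≤ n → θ ∈ Set.Ioo (π / 2) (2 * π / 3) ∧ |φ θ - ((h0 + i : ℕ) : ℝ) * π| ≤ 0.1 := by
    intro i
    by_cases hi : i ≤ n
    swap
    · exact ⟨0, fun h => absurd h hi⟩
    have hi' : (i:ℝ) ≤ n := by exact_mod_cast hi
    have hi0 : (0:ℝ) ≤ i := Nat.cast_nonneg i
    have hn1 : (1:ℝ) ≤ n := by exact_mod_cast (show 1 ≤ n by omega)
    have e1 : ((k' / 2 : ℕ) : ℝ) / 2 ≤ ((k' / 2 + 1) / 2 : ℕ) := by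
      rcases hk' with rfl | rfl | rfl | rfl | rfl | rfl <;> norm_num
    have e2 : (((k' / 2 + 1) / 2 : ℕ) : ℝ) ≤ ((k' / 2 : ℕ) : ℝ) * 2 / 3 := by
      rcases hk' with rfl | rfl | rfl | rfl | rfl | rfl <;> norm_num
    have hlo : φ (π / 2) ≤ ((h0 + i : ℕ) : ℝ) * π := by
      rw [hφ, ph_left, hh0]; push_cast at e1 ⊢; gcongr ?_ * π; linarith
    have hhi : ((h0 + i : ℕ) : ℝ) * π ≤ φ (2 * π / 3) := by
      rw [hφ, ph_right, hh0]; push_cast at e2 ⊢; gcongr ?_ * π; linarith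
    have hgap : φ (π / 2) + 1 < φ (2 * π / 3) := by
      rw [hφ, ph_right, ph_left]
      have : (3 * ℓ + ((k' / 2 : ℕ) : ℝ) / 2 + 1) * π ≤ (4 * ℓ - m + ((k' / 2 : ℕ) : ℝ) * 2 / 3) * π := by
        gcongr ?_ * π; linarith
      linarith
    obtain ⟨v, hv1, hv2, hv3⟩ := near_interior hgap hlo hhi
    have hIcc : π / 2 ≤ 2 * π / 3 := by linarith
    obtain ⟨θ, hθ, hθv⟩ := intermediate_value_Ioo hIcc (ph_cont ℓ k' m).continuousOn ⟨hv1, hv2⟩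
    refine ⟨θ, fun _ => ⟨hθ, ?_⟩⟩
    rw [hφ, hθv]; exact hv3
  choose t ht using hsamp
  set Ψ : ℝ → ℝ := fun θ => (RR ℓ k' θ * F.eval (gj θ : ℂ)).re with hΨ
  have hΨc : ContinuousOn Ψ (Set.Ioo (π / 2) (2 * π / 3)) := by
    have h1 := RR_cont (ℓ := ℓ) (kk_cases hk').1
    have h2 : ContinuousOn (fun θ => F.eval (gj θ : ℂ)) (Set.Ioo (π / 2) (2 * π / 3)) :=
      F.continuous.comp_continuousOn (Complex.continuous_ofReal.comp_continuousOn (gj_contOn.mono Set.Ioo_subset_Icc_self))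
    exact Complex.continuous_re.comp_continuousOn (h1.mul h2)
  have hΨ0 : ∀ θ ∈ Set.Ioo (π / 2) (2 * π / 3), Ψ θ = 0 → F.eval (gj θ : ℂ) = 0 := by
    intro θ hθ h
    have hr := RR_real (ℓ := ℓ) hk' (Set.Ioo_subset_Icc_self hθ)
    rw [Complex.conj_eq_iff_im] at hr
    have : RR ℓ k' θ * F.eval (gj θ : ℂ) = 0 := by
      apply Complex.ext
      · exact h
      · rw [Complex.mul_im, hr, hreal]; simp
    exact (mul_eq_zero.1 this).resolve_left (RR_ne hk' hθ)
  have hsign : ∀ i ≤ n, 0 < (-1) ^ (h0 + i) * Ψ (t i) := by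
    intro i hi
    obtain ⟨h1, h2⟩ := ht i hi
    have h3 := hest _ h1
    rw [mul_assoc, Complex.re_ofReal_mul] at h3
    set δ := φ (t i) - ((h0 + i : ℕ) : ℝ) * π with hδ
    have h4 : φ (t i) = δ + ((h0 + i : ℕ) : ℝ) * π := by rw [hδ]; ring
    rw [h4, Real.cos_add_nat_mul_pi] at h3
    have h5 : 0.995 ≤ Real.cos δ := by
      have h6 := Real.one_sub_sq_div_two_le_cos (x := δ)
      have h7 : δ ^ 2 ≤ 0.1 ^ 2 := sq_le_sq' (abs_le.1 h2).1 (abs_le.1 h2).2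
      norm_num at *; linarith
    have hE := Real.exp_pos (2 * π * m * Real.sin (t i))
    set E := Real.exp (2 * π * m * Real.sin (t i))
    change |E * Ψ (t i) - _| ≤ _ at h3
    have h8 : 0 < E * ((-1) ^ (h0 + i) * Ψ (t i)) := by
      rcases neg_one_pow_eq_or ℝ (h0 + i) with h | h <;> rw [h] at h3 ⊢ <;>
        have h9 := abs_le.1 h3 <;> norm_num at * <;> linarith
    exact pos_of_mul_pos_right h8 hE.le
  have hlt : ∀ i < n, t i < t (i + 1) := by
    intro i hi
    have h1 := (abs_le.1 (ht i hi.le).2).2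
    have h2 := (abs_le.1 (ht (i + 1) hi).2).1
    rw [← hmono.lt_iff_lt]
    push_cast at h1 h2
    norm_num at h1 h2
    change φ (t i) < φ (t (i + 1))
    linarith
  have hzero : ∀ i : ℕ, ∃ y : ℝ, i < n → y ∈ Set.Ioo (t i) (t (i + 1)) ∧ Ψ y = 0 := by
    intro i
    by_cases hi : i < n
    swap
    · exact ⟨0, fun h => absurd h hi⟩
    have hsub : Set.Icc (t i) (t (i + 1)) ⊆ Set.Ioo (π / 2) (2 * π / 3) := fun y hy =>
      ⟨(ht i hi.le).1.1.trans_le hy.1, hy.2.trans_lt (ht (i + 1) hi).1.2⟩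
    have h1 := hsign i hi.le
    have h2 := hsign (i + 1) hi
    rw [← add_assoc, pow_succ] at h2
    obtain ⟨y, hy, hy0⟩ := intermediate_value_Ioo' (hlt i hi).le (f := fun θ => (-1) ^ (h0 + i) * Ψ θ) (continuousOn_const.mul (hΨc.mono hsub))
      (show (0:ℝ) ∈ _ from ⟨by linarith, h1⟩)
    refine ⟨y, fun _ => ⟨hy, ?_⟩⟩
    exact (mul_eq_zero.1 hy0).resolve_left (pow_ne_zero _ (by norm_num))
  choose x hx using hzero
  have hxI : ∀ i < n, x i ∈ Set.Ioo (π / 2) (2 * π / 3) := fun i hi =>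
    ⟨(ht i hi.le).1.1.trans (hx i hi).1.1, (hx i hi).1.2.trans (ht (i + 1) hi).1.2⟩
  refine ⟨x, hxI, ?_, ?_⟩
  · have htm : ∀ i j, i ≤ j → j ≤ n → t i ≤ t j := by
      intro i j hij
      induction j, hij using Nat.le_induction with
      | base => exact fun _ => le_rfl
      | succ j hij ih => exact fun hj => (ih (by omega)).trans (hlt j (by omega)).le
    have hxlt : ∀ i j, i < j → j < n → x i < x j := fun i j hij hj =>
      (hx i (by omega)).1.2.trans_le ((htm (i + 1) j hij (by omega)).trans (hx j hj).1.1.le)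
    have hinj : ∀ i < n, ∀ j < n, gj (x i) = gj (x j) → i = j := by
      intro i hi j hj hij
      have := gj_injOn (Set.Ioo_subset_Icc_self (hxI i hi)) (Set.Ioo_subset_Icc_self (hxI j hj)) hij
      rcases lt_trichotomy i j with h | h | h
      · exact absurd this (hxlt i j h hj).ne
      · exact h
      · exact absurd this (hxlt j i h hi).ne'
    have hnd : ((Multiset.range n).map (fun i => (gj (x i) : ℂ))).Nodup := by
      apply Multiset.Nodup.map_on _ (Multiset.nodup_range n)
      intro i hi j hj hij
      exact hinj i (Multiset.mem_range.1 hi) j (Multiset.mem_range.1 hj) (by exact_mod_cast hij)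
    symm
    apply Multiset.eq_of_le_of_card_le
    · rw [Multiset.le_iff_subset hnd]
      intro y hy
      obtain ⟨i, hi, rfl⟩ := Multiset.mem_map.1 hy
      rw [Polynomial.mem_roots hF.1.ne_zero]
      have hi := Multiset.mem_range.1 hi
      exact hΨ0 _ (hxI i hi) (hx i hi).2
    · rw [Multiset.card_map, Multiset.card_range]
      exact F.card_roots'.trans hF.2.1.le
  · intro i hi
    have h1 := (abs_le.1 (ht i hi.le).2).1
    have h2 := (abs_le.1 (ht (i + 1) hi).2).2
    have h3 := hmono (hx i hi).1.1
    have h4 := hmono (hx i hi).1.2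
    push_cast at h1 h2
    constructor <;> linarith

end

section
set_option autoImplicit false

lemma count_lemma (n : ℕ) (y : ℕ → ℝ) (hy : ∀ i < n, (i:ℝ) - 0.1 ≤ y i ∧ y i ≤ i + 1.1) (α β : ℝ) (hαβ : α ≤ β) (hα : -1 ≤ α) (hβ : β ≤ n + 1)
    (S : Finset ℕ) (hS : ∀ i, i ∈ S ↔ i < n ∧ α ≤ y i ∧ y i ≤ β) : |(S.card : ℝ) - (β - α)| ≤ 4 := by
  have hup : (S.card : ℝ) ≤ β - α + 4 := by
    have h1 : S.map ⟨((↑) : ℕ → ℤ), Nat.cast_injective⟩ ⊆ Finset.Icc ⌈α - 1.1⌉ ⌊β + 0.1⌋ := by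
      intro j hj
      obtain ⟨i, hi, rfl⟩ := Finset.mem_map.1 hj
      obtain ⟨h1, h2, h3⟩ := (hS i).1 hi
      obtain ⟨h4, h5⟩ := hy i h1
      rw [Finset.mem_Icc, Int.ceil_le, Int.le_floor]
      simp only [Function.Embedding.coeFn_mk, Int.cast_natCast]
      constructor <;> linarith
    have h2 := Finset.card_le_card h1
    rw [Finset.card_map, Int.card_Icc] at h2
    have h3 := Int.floor_le (β + 0.1)
    have h4 := Int.le_ceil (α - 1.1)
    have h6 : (S.card : ℤ) ≤ max (⌊β + 0.1⌋ + 1 - ⌈α - 1.1⌉) 0 := by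
      rw [← Int.toNat_eq_max]; exact_mod_cast h2
    have h7 : (S.card : ℝ) ≤ max ((⌊β + 0.1⌋ : ℝ) + 1 - ⌈α - 1.1⌉) 0 := by exact_mod_cast h6
    refine h7.trans (max_le ?_ ?_) <;> norm_num at * <;> linarith
  have hlow : β - α - 4 ≤ S.card := by
    have h1 : Finset.Ico ⌈α + 0.1⌉₊ (min n ⌊β - 0.1⌋₊) ⊆ S := by
      intro i hi
      rw [Finset.mem_Ico, lt_min_iff, Nat.ceil_le] at hi
      obtain ⟨h1, h2, h3⟩ := hi
      have h4 : i + 1 ≤ ⌊β - 0.1⌋₊ := h3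
      rw [Nat.le_floor_iff' (by omega)] at h4
      push_cast at h4
      obtain ⟨h5, h6⟩ := hy i h2
      refine (hS i).2 ⟨h2, ?_, ?_⟩ <;> norm_num at * <;> linarith
    have h2 := Finset.card_le_card h1
    rw [Nat.card_Ico] at h2
    have h3 : min n ⌊β - 0.1⌋₊ ≤ S.card + ⌈α + 0.1⌉₊ := by omega
    have h4 : min (n:ℝ) (⌊β - 0.1⌋₊ : ℝ) ≤ S.card + (⌈α + 0.1⌉₊ : ℝ) := by exact_mod_cast h3
    have h5 : β - 1.1 ≤ min (n:ℝ) (⌊β - 0.1⌋₊ : ℝ) := by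
      have := Nat.lt_floor_add_one (β - 0.1)
      apply le_min <;> norm_num at * <;> linarith
    have h6 : (⌈α + 0.1⌉₊ : ℝ) ≤ α + 1.1 := by
      rcases le_total 0 (α + 0.1) with h | h
      · have := Nat.ceil_lt_add_one h
        norm_num at *; linarith
      · rw [Nat.ceil_eq_zero.2 h]
        norm_num at *; linarith
    have h7 := h5.trans h4
    norm_num at h7 h6 ⊢
    linarith
  rw [abs_le]; constructor <;> linarith

lemma count_bound (k' : ℕ) (hk' : k' = 0 ∨ k' = 4 ∨ k' = 6 ∨ k' = 8 ∨ k' = 10 ∨ k' = 14) (θ₁ θ₂ : ℝ) (hθ₁ : Real.pi / 2 ≤ θ₁) (hθ : θ₁ ≤ θ₂) (hθ₂ : θ₂ ≤ 2 * Real.pi / 3)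
    (p : ℂ → Prop) [DecidablePred p] (hp : ∀ x, p x ↔ ∃ θ ∈ Set.Icc θ₁ θ₂, x = jinv (Complex.exp (θ * Complex.I))) :
    ∃ L : ℕ, ∀ ℓ m : ℕ, L ≤ ℓ → 9 * m ≤ 2 * ℓ → ∀ (f : ℂ → ℂ) (F : Polynomial ℂ), IsMillerForm ℓ k' m f → IsFaber ℓ k' m f F →
      (∀ x ∈ F.roots, ∃ r : ℝ, r ∈ Set.Icc (0 : ℝ) 1728 ∧ x = (r : ℂ)) ∧
      |((F.roots.filter p).card : ℝ) - (ph ℓ k' m θ₂ - ph ℓ k' m θ₁) / π| ≤ 4 := by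
  classical
  obtain ⟨L, hL⟩ := roots_lemma k' hk'
  refine ⟨max L 1, fun ℓ m hℓ hm f F hf hF => ?_⟩
  obtain ⟨x, hx, hroots, hph⟩ := hL ℓ m ((le_max_left _ _).trans hℓ) hm f F hf hF
  have hℓ1 : 1 ≤ ℓ := (le_max_right _ _).trans hℓ
  have hmono := ph_mono (k' := k') (show 0 < ℓ by omega) hm
  have hpi := Real.pi_gt_three
  constructor
  · intro y hy
    rw [hroots] at hy
    obtain ⟨i, hi, rfl⟩ := Multiset.mem_map.1 hy
    have := gj_mem (hx i (Multiset.mem_range.1 hi))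
    exact ⟨_, ⟨this.1.le, this.2.le⟩, rfl⟩
  · set h0 : ℝ := ((3 * ℓ + (k' / 2 + 1) / 2 : ℕ) : ℝ) with hh0
    set S : Finset ℕ := (Finset.range (ℓ - m)).filter (fun i => p (gj (x i) : ℂ)) with hSdef
    have hcard : (F.roots.filter p).card = S.card := by
      rw [hroots, Multiset.filter_map, Multiset.card_map]; rfl
    have hpx : ∀ i < ℓ - m, (p (gj (x i) : ℂ) ↔ θ₁ ≤ x i ∧ x i ≤ θ₂) := by
      intro i hi
      have hxi := Set.Ioo_subset_Icc_self (hx i hi)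
      rw [hp]
      constructor
      · rintro ⟨θ, hθ', he⟩
        have hθI : θ ∈ Set.Icc (π / 2) (2 * π / 3) := ⟨hθ₁.trans hθ'.1, hθ'.2.trans hθ₂⟩
        change (gj (x i) : ℂ) = jinv (zt θ) at he
        rw [gj_coe hθI] at he
        have : gj (x i) = gj θ := by exact_mod_cast he
        rw [gj_injOn hxi hθI this]
        exact hθ'
      · intro h
        exact ⟨x i, h, (gj_coe hxi).symm⟩
    have key := count_lemma (ℓ - m) (fun i => ph ℓ k' m (x i) / π - h0) ?_ (ph ℓ k' m θ₁ / π - h0) (ph ℓ k' m θ₂ / π - h0) ?_ ?_ ?_ S ?_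
    · rw [hcard]
      convert key using 3; ring
    · intro i hi
      obtain ⟨h1, h2⟩ := hph i hi
      constructor
      · rw [le_sub_iff_add_le, le_div_iff₀ (by linarith)]
        norm_num at *
        linarith
      · rw [sub_le_iff_le_add, div_le_iff₀ (by linarith)]
        norm_num at *
        linarith
    · have := hmono.monotone hθ
      gcongr
    · have h1 := hmono.monotone hθ₁
      rw [ph_left] at h1
      rw [le_sub_iff_add_le, le_div_iff₀ (by linarith)]
      refine le_trans ?_ h1
      gcongr ?_ * π
      rw [hh0]
      rcases hk' with rfl | rfl | rfl | rfl | rfl | rfl <;> norm_num <;> linarith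
    · have h1 := hmono.monotone hθ₂
      rw [ph_right] at h1
      rw [sub_le_iff_le_add, div_le_iff₀ (by linarith)]
      refine h1.trans ?_
      gcongr ?_ * π
      rw [hh0, Nat.cast_sub (by omega)]
      rcases hk' with rfl | rfl | rfl | rfl | rfl | rfl <;> norm_num <;> linarith
    · intro i
      rw [hSdef, Finset.mem_filter, Finset.mem_range]
      refine and_congr_right fun hi => ?_
      rw [hpx i hi, sub_le_sub_iff_right, sub_le_sub_iff_right, div_le_div_iff_of_pos_right (by linarith), div_le_div_iff_of_pos_right (by linarith),
        hmono.le_iff_le, hmono.le_iff_le]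

end

open Classical in
/-- Theorem 2 of the paper.  Fix `k' ∈ {0,4,6,8,10,14}` and
`0 < c < 2/9`, and let `m = m(ℓ)` satisfy `m(ℓ)/ℓ → c`.  With `k = 12ℓ + k'`, all the
`ℓ - m` zeros of `f_{k,m}` corresponding to roots of the Faber polynomial lie on the
arc (i.e. the roots of `F_{k,m}` lie in `[0,1728]`), and for `π/2 ≤ θ₁ ≤ θ₂ ≤ 2π/3`
the proportion of those zeros of the form `e^{iθ}`, `θ ∈ [θ₁, θ₂]` — equivalently, of
roots of `F_{k,m}` of the form `j(e^{iθ})`, `θ ∈ [θ₁, θ₂]` — converges to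
`(6/(π(1-c)))(θ₂ - θ₁) + (2c/(1-c))(cos θ₂ - cos θ₁)`. -/
theorem limit_distribution_of_zeros (k' : ℕ)
    (hk' : k' = 0 ∨ k' = 4 ∨ k' = 6 ∨ k' = 8 ∨ k' = 10 ∨ k' = 14)
    (c : ℝ) (hc0 : 0 < c) (hc1 : c < 2 / 9)
    (m : ℕ → ℕ) (hmℓ : ∀ ℓ : ℕ, m ℓ ≤ ℓ)
    (hc : Tendsto (fun ℓ : ℕ => (m ℓ : ℝ) / (ℓ : ℝ)) atTop (𝓝 c))
    (f : ℕ → ℂ → ℂ) (F : ℕ → Polynomial ℂ)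
    (hf : ∀ ℓ : ℕ, IsMillerForm ℓ k' (m ℓ) (f ℓ))
    (hF : ∀ ℓ : ℕ, IsFaber ℓ k' (m ℓ) (f ℓ) (F ℓ))
    (θ₁ θ₂ : ℝ) (hθ₁ : Real.pi / 2 ≤ θ₁) (hθ : θ₁ ≤ θ₂) (hθ₂ : θ₂ ≤ 2 * Real.pi / 3) :
    (∀ᶠ ℓ in atTop, ∀ x ∈ (F ℓ).roots, ∃ r : ℝ, r ∈ Set.Icc (0 : ℝ) 1728 ∧ x = (r : ℂ)) ∧
    Tendsto
      (fun ℓ : ℕ =>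
        ((((F ℓ).roots.filter
            (fun x => ∃ θ ∈ Set.Icc θ₁ θ₂, x = jinv (Complex.exp (θ * Complex.I)))).card : ℝ)
          / ((ℓ - m ℓ : ℕ) : ℝ)))
      atTop
      (𝓝 ((6 / (Real.pi * (1 - c))) * (θ₂ - θ₁)
            + (2 * c / (1 - c)) * (Real.cos θ₂ - Real.cos θ₁))) := by
  obtain ⟨L, hL⟩ := count_bound k' hk' θ₁ θ₂ hθ₁ hθ hθ₂ (fun x => ∃ θ ∈ Set.Icc θ₁ θ₂, x = jinv (Complex.exp (θ * Complex.I))) (fun x => Iff.rfl)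
  have hev : ∀ᶠ ℓ : ℕ in atTop, 9 * m ℓ ≤ 2 * ℓ := by
    filter_upwards [hc.eventually_lt_const hc1, eventually_gt_atTop 0] with ℓ h1 h2
    have h3 : (0:ℝ) < ℓ := by exact_mod_cast h2
    rw [div_lt_iff₀ h3] at h1
    have : (9:ℝ) * m ℓ ≤ 2 * ℓ := by linarith
    exact_mod_cast this
  have hmain := (hev.and (eventually_ge_atTop L)).mono fun ℓ h =>
    hL ℓ (m ℓ) h.2 h.1 (f ℓ) (F ℓ) (hf ℓ) (hF ℓ)
  refine ⟨hmain.mono fun ℓ h => h.1, ?_⟩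
  have hpi := Real.pi_pos
  have h1c : (1 - c) ≠ 0 := by linarith
  have hinv : Tendsto (fun ℓ : ℕ => ((ℓ:ℝ))⁻¹) atTop (𝓝 0) := tendsto_inv_atTop_zero.comp tendsto_natCast_atTop_atTop
  -- all limits in terms of ratio to ℓ
  have hden : Tendsto (fun ℓ : ℕ => 1 - (m ℓ : ℝ) / ℓ) atTop (𝓝 (1 - c)) := hc.const_sub 1
  have hmain2 : Tendsto (fun ℓ : ℕ => (((6 + (k' / 2 : ℕ) * (ℓ:ℝ)⁻¹) * (θ₂ - θ₁) + 2 * π * ((m ℓ : ℝ) / ℓ) * (Real.cos θ₂ - Real.cos θ₁)) / π) / (1 - (m ℓ : ℝ) / ℓ)) atTop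
      (𝓝 ((((6 + (k' / 2 : ℕ) * 0) * (θ₂ - θ₁) + 2 * π * c * (Real.cos θ₂ - Real.cos θ₁)) / π) / (1 - c))) := by
    refine Tendsto.div (Tendsto.div_const (Tendsto.add (Tendsto.mul_const _ (Tendsto.const_add _ (hinv.const_mul _))) (Tendsto.mul_const _ (hc.const_mul _))) _) hden h1c
  have hlim : (((6 + (k' / 2 : ℕ) * 0) * (θ₂ - θ₁) + 2 * π * c * (Real.cos θ₂ - Real.cos θ₁)) / π) / (1 - c) = (6 / (Real.pi * (1 - c))) * (θ₂ - θ₁)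
            + (2 * c / (1 - c)) * (Real.cos θ₂ - Real.cos θ₁) := by
    field_simp; ring
  rw [← hlim]
  have herr : Tendsto (fun ℓ : ℕ => (4 * (ℓ:ℝ)⁻¹) / (1 - (m ℓ : ℝ) / ℓ)) atTop (𝓝 0) := by
    have := (hinv.const_mul 4).div hden h1c
    rw [mul_zero, zero_div] at this
    exact this
  refine tendsto_of_tendsto_of_dist hmain2 ?_
  refine squeeze_zero' (Eventually.of_forall fun _ => dist_nonneg) ?_ herr
  filter_upwards [hmain, hev, eventually_gt_atTop 0] with ℓ h1 h2 h3
  have h3' : (0:ℝ) < ℓ := by exact_mod_cast h3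
  have h2' : (9:ℝ) * m ℓ ≤ 2 * ℓ := by exact_mod_cast h2
  have hcast : ((ℓ - m ℓ : ℕ) : ℝ) = ℓ - m ℓ := Nat.cast_sub (hmℓ ℓ)
  have hpos : (0:ℝ) < ℓ - m ℓ := by linarith
  have e1 : (((6 + (k' / 2 : ℕ) * (ℓ:ℝ)⁻¹) * (θ₂ - θ₁) + 2 * π * ((m ℓ : ℝ) / ℓ) * (Real.cos θ₂ - Real.cos θ₁)) / π) / (1 - (m ℓ : ℝ) / ℓ) = ((ph ℓ k' (m ℓ) θ₂ - ph ℓ k' (m ℓ) θ₁) / π) / (ℓ - m ℓ) := by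
    unfold ph
    push_cast
    field_simp
    ring
  have e2 : (4 * (ℓ:ℝ)⁻¹) / (1 - (m ℓ : ℝ) / ℓ) = 4 / (ℓ - m ℓ) := by
    field_simp
  rw [e1, e2, hcast, dist_comm, Real.dist_eq, ← sub_div, abs_div, abs_of_pos hpos]
  gcongr
  exact h1.2
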